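/- Assuming the condition a^{1/4} · max_{(T,x)∈D} ∫_I (U(x,ξ)/ξ) tanh(ξ/(2T)) dξ ≤ 1, the operator A maps W into W, and the set AW = { Af : f ∈ W } is relatively compact in the Banach space C(D). -/

import Mathlib

open Set MeasureTheory Filter Topology

noncomputable section

/-- The context of the BCS-Bogoliubov model: the cutoff `eps`, the Debye energy `om = ℏω_D`,
the potential `U` with bounds `U₁ ≤ U ≤ U₂`, the constant `a`, the temperatures
`tau₁, tau₂, T₀, Tc`, the solutions `Δ₁, Δ₂` of the constant-potential gap equations,
the constant `Mz = max_{z ≥ 0} z / cosh z` and the constant `MT = M_T`. -/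
structure BCSContext where
  eps : ℝ
  om : ℝ
  U : ℝ → ℝ → ℝ
  U₁ : ℝ
  U₂ : ℝ
  Umax : ℝ
  Umin : ℝ
  a : ℝ
  tau₁ : ℝ
  tau₂ : ℝ
  Δ₁ : ℝ → ℝ
  Δ₂ : ℝ → ℝ
  Tc : ℝ
  T₀ : ℝ
  Mz : ℝ
  MT : ℝ
  heps : 0 < eps
  hepsom : eps < om
  hU₁pos : 0 < U₁
  hU₁₂ : U₁ ≤ U₂
  hUsmooth : ContDiffOn ℝ 2 (fun p : ℝ × ℝ => U p.1 p.2) (Icc eps om ×ˢ Icc eps om)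
  hUlb : ∀ x ∈ Icc eps om, ∀ ξ ∈ Icc eps om, U₁ ≤ U x ξ
  hUub : ∀ x ∈ Icc eps om, ∀ ξ ∈ Icc eps om, U x ξ ≤ U₂
  hUmax : IsGreatest (Set.image2 U (Icc eps om) (Icc eps om)) Umax
  hUmin : IsLeast (Set.image2 U (Icc eps om) (Icc eps om)) Umin
  ha : a = (Umax / Umin) ^ 2
  htau₁pos : 0 < tau₁
  htau₂pos : 0 < tau₂
  htau₁ : 1 = U₁ * (∫ ξ in eps..om, Real.tanh (ξ / (2 * tau₁)) / ξ)
  htau₂ : 1 = U₂ * (∫ ξ in eps..om, Real.tanh (ξ / (2 * tau₂)) / ξ)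
  hΔ₁nonneg : ∀ T, 0 ≤ Δ₁ T
  hΔ₂nonneg : ∀ T, 0 ≤ Δ₂ T
  hΔ₁cont : Continuous Δ₁
  hΔ₂cont : Continuous Δ₂
  hΔ₁anti : StrictAntiOn Δ₁ (Icc 0 tau₁)
  hΔ₂anti : StrictAntiOn Δ₂ (Icc 0 tau₂)
  hΔ₁eq : ∀ T ∈ Ioc 0 tau₁, U₁ * (∫ ξ in eps..om,
      Real.tanh (Real.sqrt (ξ ^ 2 + Δ₁ T ^ 2) / (2 * T)) / Real.sqrt (ξ ^ 2 + Δ₁ T ^ 2)) = 1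
  hΔ₂eq : ∀ T ∈ Ioc 0 tau₂, U₂ * (∫ ξ in eps..om,
      Real.tanh (Real.sqrt (ξ ^ 2 + Δ₂ T ^ 2) / (2 * T)) / Real.sqrt (ξ ^ 2 + Δ₂ T ^ 2)) = 1
  hΔ₁zero : ∀ T, tau₁ ≤ T → Δ₁ T = 0
  hΔ₂zero : ∀ T, tau₂ ≤ T → Δ₂ T = 0
  hTc₁ : tau₁ ≤ Tc
  hTc₂ : Tc ≤ tau₂
  hT₀₁ : tau₁ < T₀
  hT₀₂ : T₀ < Tc
  hMz : IsGreatest ((fun z => z / Real.cosh z) '' Set.Ici (0 : ℝ)) Mz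
  hMT : MT = 4 * a * U₂ * Mz ^ 2 /
      (eps * U₁ *
        (Real.tanh (eps / (2 * Tc)) - (eps / (2 * Tc)) / Real.cosh (eps / (2 * Tc)) ^ 2) *
        (∫ ξ in eps..om, (ξ ^ 2 + Δ₂ 0 ^ 2) ^ (-(3 : ℝ) / 2)))

namespace BCSContext

/-- The energy interval `I = [ε, ℏω_D]`. -/
def Iset (C : BCSContext) : Set ℝ := Icc C.eps C.om

/-- The rectangle `D = [T₀, T_c] × I`. -/
def Dset (C : BCSContext) : Set (ℝ × ℝ) := Icc C.T₀ C.Tc ×ˢ Icc C.eps C.om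

end BCSContext

/-- The operator `A` of the squared BCS-Bogoliubov gap equation. -/
def opA (C : BCSContext) (f : ℝ → ℝ → ℝ) (T x : ℝ) : ℝ :=
  (∫ ξ in C.eps..C.om, C.U x ξ * Real.sqrt (f T ξ / (ξ ^ 2 + f T ξ)) *
      Real.tanh (Real.sqrt (ξ ^ 2 + f T ξ) / (2 * T))) ^ 2

/-- Partial derivative with respect to the temperature `T` (within `[T₀, T_c]`). -/
def pderivT (C : BCSContext) (g : ℝ → ℝ → ℝ) (T x : ℝ) : ℝ :=
  derivWithin (fun s => g s x) (Icc C.T₀ C.Tc) T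

/-- Partial derivative with respect to the energy `x` (within `I = [ε, ℏω_D]`). -/
def pderivX (C : BCSContext) (g : ℝ → ℝ → ℝ) (T x : ℝ) : ℝ :=
  derivWithin (fun y => g T y) (Icc C.eps C.om) x

/-- Membership in the set `W`. -/
def memW (C : BCSContext) (f : ℝ → ℝ → ℝ) : Prop :=
  ContDiffOn ℝ 2 (fun p : ℝ × ℝ => f p.1 p.2) C.Dset ∧
  (∀ T ∈ Icc C.T₀ C.Tc, ∀ x ∈ C.Iset, C.Δ₁ T ^ 2 ≤ f T x ∧ f T x ≤ C.Δ₂ T ^ 2) ∧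
  (∀ x ∈ C.Iset, f C.Tc x = 0) ∧
  (∀ T ∈ Ico C.T₀ C.Tc, ∀ x ∈ C.Iset, ∀ x₁ ∈ C.Iset, f T x ≤ C.a * f T x₁) ∧
  (∀ x ∈ C.Iset, ∀ x₁ ∈ C.Iset,
      -(pderivT C f C.Tc x) ≤ C.a * -(pderivT C f C.Tc x₁)) ∧
  (∀ T ∈ Icc C.T₀ C.Tc, ∀ x ∈ C.Iset, pderivT C f T x < 0) ∧
  (∀ T ∈ Icc C.T₀ C.Tc, ∀ x ∈ C.Iset, -(pderivT C f T x) ≤ C.MT)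

/-- The condition `a^{1/4} · max_{(T,x) ∈ D} ∫_I (U(x,ξ)/ξ) tanh(ξ/(2T)) dξ ≤ 1`. -/
def gapCondition (C : BCSContext) : Prop :=
  ∀ T ∈ Icc C.T₀ C.Tc, ∀ x ∈ C.Iset,
    C.a ^ ((1 : ℝ) / 4) * (∫ ξ in C.eps..C.om, C.U x ξ / ξ * Real.tanh (ξ / (2 * T))) ≤ 1

instance (C : BCSContext) : CompactSpace ↥C.Dset :=
  isCompact_iff_compactSpace.mp (isCompact_Icc.prod isCompact_Icc)

-- Extension of a continuous function on `D` to a function on `ℝ × ℝ` (by `0` outside `D`).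
open Classical in
def extFun (C : BCSContext) (F : C(↥C.Dset, ℝ)) : ℝ → ℝ → ℝ :=
  fun T x => if h : (T, x) ∈ C.Dset then F ⟨(T, x), h⟩ else 0

/-- The set `W` regarded as a subset of the Banach space `C(D)`. -/
def WSet (C : BCSContext) : Set C(↥C.Dset, ℝ) :=
  {F | ∃ f : ℝ → ℝ → ℝ, memW C f ∧ ∀ p : ↥C.Dset, F p = f (p : ℝ × ℝ).1 (p : ℝ × ℝ).2}

/-- First-order Taylor bound on a convex set of reals, when the derivative stays close to `m`. -/
lemma Convex.abs_sub_sub_mul_le {s : Set ℝ} (hs : Convex ℝ s) {f f' : ℝ → ℝ}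
    (hf : ∀ z ∈ s, HasDerivWithinAt f (f' z) s z) {m e : ℝ} (h : ∀ z ∈ s, |f' z - m| ≤ e)
    {x y : ℝ} (hx : x ∈ s) (hy : y ∈ s) : |f y - f x - m * (y - x)| ≤ e * |y - x| := by
  have key := hs.norm_image_sub_le_of_norm_hasDerivWithin_le (f := fun z => f z - m * z)
    (f' := fun z => f' z - m) (C := e)
    (fun z hz => by simpa using (hf z hz).fun_sub ((hasDerivWithinAt_id z s).const_mul m))
    (fun z hz => by simpa using h z hz) hx hy
  simp only [Real.norm_eq_abs] at key
  convert key using 2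
  ring

section Rectangle

variable {a b c d : ℝ} {g g₁ g₂ : ℝ → ℝ → ℝ}

/-- A function on a closed rectangle with continuous partial derivatives is differentiable. -/
lemma hasFDerivWithinAt_of_partials
    (h₁ : ∀ T ∈ Icc a b, ∀ x ∈ Icc c d,
      HasDerivWithinAt (fun s => g s x) (g₁ T x) (Icc a b) T)
    (h₂ : ∀ T ∈ Icc a b, ∀ x ∈ Icc c d,
      HasDerivWithinAt (fun y => g T y) (g₂ T x) (Icc c d) x)
    (c₁ : ContinuousOn (fun p : ℝ × ℝ => g₁ p.1 p.2) (Icc a b ×ˢ Icc c d))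
    {p : ℝ × ℝ} (hp : p ∈ Icc a b ×ˢ Icc c d) :
    HasFDerivWithinAt (fun p : ℝ × ℝ => g p.1 p.2)
      (g₁ p.1 p.2 • ContinuousLinearMap.fst ℝ ℝ ℝ + g₂ p.1 p.2 • ContinuousLinearMap.snd ℝ ℝ ℝ)
      (Icc a b ×ˢ Icc c d) p := by
  obtain ⟨T, x⟩ := p
  rw [hasFDerivWithinAt_iff_isLittleO, Asymptotics.isLittleO_iff]
  intro e he
  have hx := (h₂ T hp.1 x hp.2)
  rw [hasDerivWithinAt_iff_isLittleO, Asymptotics.isLittleO_iff] at hx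
  have hx' := hx (half_pos he)
  rw [eventually_nhdsWithin_iff, Metric.eventually_nhds_iff] at hx'
  obtain ⟨δ₁, hδ₁, hx'⟩ := hx'
  obtain ⟨δ₂, hδ₂, hc⟩ := Metric.continuousWithinAt_iff.1 (c₁ (T, x) hp) (e / 2) (half_pos he)
  rw [eventually_nhdsWithin_iff, Metric.eventually_nhds_iff]
  refine ⟨min δ₁ δ₂, lt_min hδ₁ hδ₂, ?_⟩
  rintro ⟨T', x'⟩ hd ⟨hT', hx'I⟩
  simp only at hT' hx'I
  rw [Prod.dist_eq, max_lt_iff] at hd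
  obtain ⟨hd1, hd2⟩ := hd
  simp only at hd1 hd2
  have e2 := hx' (hd2.trans_le (min_le_left _ _)) hx'I
  have conv : Convex ℝ (Icc a b ∩ Metric.ball T δ₂) := (convex_Icc a b).inter (convex_ball _ _)
  have e1 := conv.abs_sub_sub_mul_le (f := fun s => g s x') (f' := fun s => g₁ s x')
    (m := g₁ T x) (e := e / 2)
    (fun z hz => (h₁ z hz.1 x' hx'I).mono inter_subset_left)
    (fun z hz => by
      have := hc (x := (z, x')) ⟨hz.1, hx'I⟩ (by
        rw [Prod.dist_eq, max_lt_iff]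
        exact ⟨hz.2, hd2.trans_le (min_le_right _ _)⟩)
      simpa [Real.dist_eq] using this.le)
    (x := T) (y := T') ⟨hp.1, Metric.mem_ball_self hδ₂⟩ ⟨hT', hd1.trans_le (min_le_right _ _)⟩
  simp only [Real.norm_eq_abs, smul_eq_mul] at e2
  have n1 : |T' - T| ≤ ‖((T', x') : ℝ × ℝ) - (T, x)‖ := by
    simp
  have n2 : |x' - x| ≤ ‖((T', x') : ℝ × ℝ) - (T, x)‖ := by
    simp
  simp only [Real.norm_eq_abs, add_apply, smul_apply,
    ContinuousLinearMap.coe_fst', ContinuousLinearMap.coe_snd', smul_eq_mul, Prod.fst_sub,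
    Prod.snd_sub]
  calc |g T' x' - g T x - (g₁ T x * (T' - T) + g₂ T x * (x' - x))|
      = |(g T' x' - g T x' - g₁ T x * (T' - T)) + (g T x' - g T x - (x' - x) * g₂ T x)| := by
        congr 1; ring
    _ ≤ e / 2 * |T' - T| + e / 2 * |x' - x| := (abs_add_le _ _).trans (add_le_add e1 e2)
    _ ≤ e / 2 * ‖((T', x') : ℝ × ℝ) - (T, x)‖ + e / 2 * ‖((T', x') : ℝ × ℝ) - (T, x)‖ := by
        gcongr
    _ = e * ‖((T', x') : ℝ × ℝ) - (T, x)‖ := by ring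

lemma uniqueDiffOn_rectangle (hab : a < b) (hcd : c < d) :
    UniqueDiffOn ℝ (Icc a b ×ˢ Icc c d) :=
  (uniqueDiffOn_Icc hab).prod (uniqueDiffOn_Icc hcd)

/-- A function whose partial derivatives are `Cⁿ` on a closed rectangle is `Cⁿ⁺¹` there. -/
lemma contDiffOn_succ_of_partials (hab : a < b) (hcd : c < d) {n : ℕ}
    (h₁ : ∀ T ∈ Icc a b, ∀ x ∈ Icc c d,
      HasDerivWithinAt (fun s => g s x) (g₁ T x) (Icc a b) T)
    (h₂ : ∀ T ∈ Icc a b, ∀ x ∈ Icc c d,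
      HasDerivWithinAt (fun y => g T y) (g₂ T x) (Icc c d) x)
    (c₁ : ContDiffOn ℝ n (fun p : ℝ × ℝ => g₁ p.1 p.2) (Icc a b ×ˢ Icc c d))
    (c₂ : ContDiffOn ℝ n (fun p : ℝ × ℝ => g₂ p.1 p.2) (Icc a b ×ˢ Icc c d)) :
    ContDiffOn ℝ (n + 1) (fun p : ℝ × ℝ => g p.1 p.2) (Icc a b ×ˢ Icc c d) := by
  rw [contDiffOn_succ_iff_hasFDerivWithinAt_of_uniqueDiffOn (uniqueDiffOn_rectangle hab hcd)]
  refine ⟨fun h => by simp at h, _, ?_, fun p hp =>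
    hasFDerivWithinAt_of_partials h₁ h₂ c₁.continuousOn hp⟩
  exact (c₁.smul contDiffOn_const).add (c₂.smul contDiffOn_const)

/-- A `Cⁿ⁺¹` function on a closed rectangle has `Cⁿ` partial derivatives. -/
lemma exists_partials_of_contDiffOn_succ (hab : a < b) (hcd : c < d) {n : ℕ}
    (h : ContDiffOn ℝ (n + 1) (fun p : ℝ × ℝ => g p.1 p.2) (Icc a b ×ˢ Icc c d)) :
    ∃ g₁ g₂ : ℝ → ℝ → ℝ,
      ContDiffOn ℝ n (fun p : ℝ × ℝ => g₁ p.1 p.2) (Icc a b ×ˢ Icc c d) ∧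
      ContDiffOn ℝ n (fun p : ℝ × ℝ => g₂ p.1 p.2) (Icc a b ×ˢ Icc c d) ∧
      (∀ T ∈ Icc a b, ∀ x ∈ Icc c d,
        HasDerivWithinAt (fun s => g s x) (g₁ T x) (Icc a b) T) ∧
      (∀ T ∈ Icc a b, ∀ x ∈ Icc c d,
        HasDerivWithinAt (fun y => g T y) (g₂ T x) (Icc c d) x) := by
  obtain ⟨-, f', hf', hd⟩ := (contDiffOn_succ_iff_hasFDerivWithinAt_of_uniqueDiffOn
    (uniqueDiffOn_rectangle hab hcd)).1 h
  refine ⟨fun T x => f' (T, x) (1, 0), fun T x => f' (T, x) (0, 1),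
    hf'.clm_apply contDiffOn_const, hf'.clm_apply contDiffOn_const, fun T hT x hx => ?_,
    fun T hT x hx => ?_⟩
  · exact (hd (T, x) ⟨hT, hx⟩).comp_hasDerivWithinAt_of_eq T
      ((hasDerivWithinAt_id T _).prodMk (hasDerivWithinAt_const T _ x)) (fun s hs => ⟨hs, hx⟩) rfl
  · exact (hd (T, x) ⟨hT, hx⟩).comp_hasDerivWithinAt_of_eq x
      ((hasDerivWithinAt_const x _ T).prodMk (hasDerivWithinAt_id x _)) (fun s hs => ⟨hT, hs⟩) rfl

/-- Slices of a continuous function on a rectangle are continuous. -/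
lemma ContinuousOn.slice_snd
    (h : ContinuousOn (fun p : ℝ × ℝ => g p.1 p.2) (Icc a b ×ˢ Icc c d)) {T : ℝ}
    (hT : T ∈ Icc a b) : ContinuousOn (fun x => g T x) (Icc c d) :=
  h.comp (f := fun x => (T, x)) (by fun_prop) fun _ hx => ⟨hT, hx⟩

/-- Differentiation under the integral sign on a closed rectangle. -/
lemma hasDerivWithinAt_integral_of_partial (hcd : c ≤ d)
    (h₁ : ∀ T ∈ Icc a b, ∀ x ∈ Icc c d,
      HasDerivWithinAt (fun s => g s x) (g₁ T x) (Icc a b) T)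
    (c₀ : ContinuousOn (fun p : ℝ × ℝ => g p.1 p.2) (Icc a b ×ˢ Icc c d))
    (c₁ : ContinuousOn (fun p : ℝ × ℝ => g₁ p.1 p.2) (Icc a b ×ˢ Icc c d))
    {T : ℝ} (hT : T ∈ Icc a b) :
    HasDerivWithinAt (fun s => ∫ x in c..d, g s x) (∫ x in c..d, g₁ T x) (Icc a b) T := by
  have int : ∀ {k : ℝ → ℝ → ℝ}, ContinuousOn (fun p : ℝ × ℝ => k p.1 p.2) (Icc a b ×ˢ Icc c d) →
      ∀ {s}, s ∈ Icc a b → IntervalIntegrable (fun x => k s x) volume c d := fun hk s hs =>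
    (hk.slice_snd hs).intervalIntegrable_of_Icc hcd
  have unif := (isCompact_Icc.prod isCompact_Icc).uniformContinuousOn_of_continuous c₁
  rw [Metric.uniformContinuousOn_iff] at unif
  rw [hasDerivWithinAt_iff_isLittleO, Asymptotics.isLittleO_iff]
  intro e he
  have hpos : 0 < d - c + 1 := by linarith
  obtain ⟨δ, hδ, hu⟩ := unif (e / (d - c + 1)) (by positivity)
  rw [eventually_nhdsWithin_iff, Metric.eventually_nhds_iff]
  refine ⟨δ, hδ, fun T' hd hT' => ?_⟩
  have conv : Convex ℝ (Icc a b ∩ Metric.ball T δ) := (convex_Icc a b).inter (convex_ball _ _)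
  have key : ∀ x ∈ Icc c d,
      |g T' x - g T x - g₁ T x * (T' - T)| ≤ e / (d - c + 1) * |T' - T| := fun x hx =>
    conv.abs_sub_sub_mul_le (f := fun s => g s x) (f' := fun s => g₁ s x)
      (fun z hz => (h₁ z hz.1 x hx).mono inter_subset_left)
      (fun z hz => by
        have := hu (z, x) ⟨hz.1, hx⟩ (T, x) ⟨hT, hx⟩ (by
          rw [Prod.dist_eq, max_lt_iff]
          exact ⟨hz.2, by simpa using hδ⟩)
        simpa [Real.dist_eq] using this.le)
      ⟨hT, Metric.mem_ball_self hδ⟩ ⟨hT', hd⟩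
  have eq : (∫ x in c..d, g T' x) - (∫ x in c..d, g T x) - (T' - T) • ∫ x in c..d, g₁ T x
      = ∫ x in c..d, (g T' x - g T x - g₁ T x * (T' - T)) := by
    rw [intervalIntegral.integral_sub ((int c₀ hT').sub (int c₀ hT)) ((int c₁ hT).mul_const _),
      intervalIntegral.integral_sub (int c₀ hT') (int c₀ hT), intervalIntegral.integral_mul_const,
      smul_eq_mul, mul_comm]
  rw [eq]
  have b1 := intervalIntegral.norm_integral_le_of_norm_le_const (a := c) (b := d)
    (f := fun x => g T' x - g T x - g₁ T x * (T' - T)) (C := e / (d - c + 1) * |T' - T|)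
    (fun x hx => by
      rw [uIoc_of_le hcd] at hx
      exact key x (Ioc_subset_Icc_self hx))
  refine b1.trans ?_
  rw [abs_of_nonneg (sub_nonneg.2 hcd), Real.norm_eq_abs]
  have : e / (d - c + 1) * (d - c) ≤ e := by
    rw [div_mul_eq_mul_div, div_le_iff₀ hpos]; nlinarith
  calc e / (d - c + 1) * |T' - T| * (d - c) = e / (d - c + 1) * (d - c) * |T' - T| := by ring
    _ ≤ e * |T' - T| := by gcongr

end Rectangle

/-- Continuity of an integral depending on a parameter in a set. -/
lemma ContinuousOn.intervalIntegral_param {X : Type*} [TopologicalSpace X] {S : Set X} {c d : ℝ}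
    (hcd : c ≤ d) {k : X → ℝ → ℝ}
    (hk : ContinuousOn (fun q : X × ℝ => k q.1 q.2) (S ×ˢ Icc c d)) :
    ContinuousOn (fun p => ∫ t in c..d, k p t) S := by
  rw [continuousOn_iff_continuous_domRestrict]
  have h : Continuous fun q : S × ℝ => k q.1 (projIcc c d hcd q.2) :=
    hk.comp_continuous (f := fun q : S × ℝ => ((q.1 : X), (projIcc c d hcd q.2 : ℝ)))
      (by fun_prop) fun q => ⟨q.1.2, (projIcc c d hcd q.2).2⟩
  have h' := intervalIntegral.continuous_parametric_intervalIntegral_of_continuous'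
    (μ := volume) (f := fun (p : S) t => k p (projIcc c d hcd t)) h c d
  convert h' using 1
  ext p
  refine intervalIntegral.integral_congr fun t ht => ?_
  rw [uIcc_of_le hcd] at ht
  simp [projIcc_of_mem hcd ht]

namespace Real

lemma hasDerivAt_tanh (y : ℝ) : HasDerivAt tanh (1 / cosh y ^ 2) y := by
  have h := (hasDerivAt_sinh y).div (hasDerivAt_cosh y) (cosh_pos y).ne'
  have e : tanh = sinh / cosh := by ext z; simp [tanh_eq_sinh_div_cosh]
  have e' : (1 : ℝ) = cosh y * cosh y - sinh y * sinh y := by nlinarith [cosh_sq y]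
  rw [e, e']
  exact h

lemma contDiff_tanh {n : WithTop ℕ∞} : ContDiff ℝ n tanh := by
  have e : tanh = fun z => sinh z / cosh z := by ext z; simp [tanh_eq_sinh_div_cosh]
  rw [e]
  exact contDiff_sinh.div contDiff_cosh fun x => (cosh_pos x).ne'

lemma strictMono_tanh : StrictMono tanh :=
  strictMono_of_deriv_pos fun y => by
    rw [(hasDerivAt_tanh y).deriv]
    have := cosh_pos y
    positivity

lemma tanh_pos {y : ℝ} (hy : 0 < y) : 0 < tanh y := by
  simpa using strictMono_tanh hy

lemma strictMonoOn_tanh_sub_div_cosh_sq :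
    StrictMonoOn (fun y : ℝ => tanh y - y / cosh y ^ 2) (Ici 0) := by
  have hd : ∀ y : ℝ, HasDerivAt (fun y : ℝ => tanh y - y / cosh y ^ 2)
      (2 * y * sinh y / cosh y ^ 3) y := fun y => by
    have hc := (cosh_pos y).ne'
    refine ((hasDerivAt_tanh y).fun_sub ((hasDerivAt_id' y).fun_div
      ((hasDerivAt_cosh y).fun_pow 2) (pow_ne_zero 2 hc))).congr_deriv ?_
    field_simp
    push_cast
    ring
  refine strictMonoOn_of_deriv_pos (convex_Ici 0)
    (fun y _ => (hd y).continuousAt.continuousWithinAt) fun y hy => ?_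
  rw [interior_Ici] at hy
  rw [(hd y).deriv]
  have h0 : (0 : ℝ) < y := hy
  have h1 := cosh_pos y
  have h2 := sinh_pos_iff.2 h0
  positivity

lemma tanh_sub_div_cosh_sq_pos {y : ℝ} (hy : 0 < y) : 0 < tanh y - y / cosh y ^ 2 := by
  simpa using strictMonoOn_tanh_sub_div_cosh_sq self_mem_Ici hy.le hy

lemma antitoneOn_tanh_div_self : AntitoneOn (fun y : ℝ => tanh y / y) (Ioi 0) := by
  have hd : ∀ y : ℝ, 0 < y → HasDerivAt (fun y : ℝ => tanh y / y)
      (-(tanh y - y / cosh y ^ 2) / y ^ 2) y := fun y hy => by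
    refine ((hasDerivAt_tanh y).fun_div (hasDerivAt_id' y) hy.ne').congr_deriv ?_
    ring
  refine antitoneOn_of_deriv_nonpos (convex_Ioi 0)
    (fun y hy => (hd y hy).continuousAt.continuousWithinAt)
    (fun y hy => ?_) fun y hy => ?_
  · rw [interior_Ioi] at hy
    exact (hd y hy).differentiableAt.differentiableWithinAt
  · rw [interior_Ioi] at hy
    rw [(hd y hy).deriv, neg_div]
    have := tanh_sub_div_cosh_sq_pos hy
    have : (0 : ℝ) < y := hy
    simp only [Left.neg_nonpos_iff]
    positivity

lemma tanh_div_div_self_le {x y t : ℝ} (hx : 0 < x) (hxy : x ≤ y) (ht : 0 < t) :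
    tanh (y / t) / y ≤ tanh (x / t) / x := by
  have h := antitoneOn_tanh_div_self (div_pos hx ht) (div_pos (hx.trans_le hxy) ht)
    (div_le_div_of_nonneg_right hxy ht.le)
  simp only at h
  rw [div_div_eq_mul_div, div_div_eq_mul_div, mul_div_right_comm, mul_div_right_comm] at h
  exact le_of_mul_le_mul_right h ht

end Real

section Division

variable {a b c d : ℝ}

/-- Hadamard's lemma on a rectangle: a `C²` function vanishing on the edge `T = b` is the product
of `b - T` and a `C¹` function. -/
lemma exists_eq_sub_mul_of_contDiffOn (hab : a < b) (hcd : c < d) {f f₁ : ℝ → ℝ → ℝ}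
    (h₁ : ∀ T ∈ Icc a b, ∀ x ∈ Icc c d,
      HasDerivWithinAt (fun s => f s x) (f₁ T x) (Icc a b) T)
    (hf₁ : ContDiffOn ℝ 1 (fun p : ℝ × ℝ => f₁ p.1 p.2) (Icc a b ×ˢ Icc c d))
    (h0 : ∀ x ∈ Icc c d, f b x = 0) :
    ∃ h : ℝ → ℝ → ℝ, ContDiffOn ℝ 1 (fun p : ℝ × ℝ => h p.1 p.2) (Icc a b ×ˢ Icc c d) ∧
      ∀ T ∈ Icc a b, ∀ x ∈ Icc c d, f T x = (b - T) * h T x := by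
  obtain ⟨f₁₁, f₁₂, c₁₁, c₁₂, d₁₁, d₁₂⟩ := exists_partials_of_contDiffOn_succ hab hcd (n := 0)
    (by simpa using hf₁)
  have c₁ := hf₁.continuousOn
  replace c₁₁ := c₁₁.continuousOn
  replace c₁₂ := c₁₂.continuousOn
  have mem : ∀ {T u : ℝ}, T ∈ Icc a b → u ∈ Icc (0 : ℝ) 1 → T + u * (b - T) ∈ Icc a b :=
    fun {T u} hT hu => ⟨by nlinarith [hT.1, hT.2, hu.1], by nlinarith [hT.1, hT.2, hu.2]⟩
  have cont : ∀ {k : ℝ → ℝ → ℝ}, ContinuousOn (fun p : ℝ × ℝ => k p.1 p.2) (Icc a b ×ˢ Icc c d) →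
      ContinuousOn (fun q : (ℝ × ℝ) × ℝ => k (q.1.1 + q.2 * (b - q.1.1)) q.1.2)
        ((Icc a b ×ˢ Icc c d) ×ˢ Icc (0 : ℝ) 1) := fun hk =>
    hk.comp (f := fun q : (ℝ × ℝ) × ℝ => (q.1.1 + q.2 * (b - q.1.1), q.1.2)) (by fun_prop)
      fun q hq => ⟨mem hq.1.1 hq.2, hq.1.2⟩
  have contT : ∀ {k : ℝ → ℝ → ℝ}, ContinuousOn (fun p : ℝ × ℝ => k p.1 p.2)
      (Icc a b ×ˢ Icc c d) → ∀ {x}, x ∈ Icc c d →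
      ContinuousOn (fun q : ℝ × ℝ => k (q.1 + q.2 * (b - q.1)) x) (Icc a b ×ˢ Icc (0 : ℝ) 1) :=
    fun hk x hx => (cont hk).comp (f := fun q : ℝ × ℝ => ((q.1, x), q.2)) (by fun_prop)
      fun q hq => ⟨⟨hq.1, hx⟩, hq.2⟩
  have contx : ∀ {k : ℝ → ℝ → ℝ}, ContinuousOn (fun p : ℝ × ℝ => k p.1 p.2)
      (Icc a b ×ˢ Icc c d) → ∀ {T}, T ∈ Icc a b →
      ContinuousOn (fun q : ℝ × ℝ => k (T + q.2 * (b - T)) q.1) (Icc c d ×ˢ Icc (0 : ℝ) 1) :=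
    fun hk T hT => (cont hk).comp (f := fun q : ℝ × ℝ => ((T, q.1), q.2)) (by fun_prop)
      fun q hq => ⟨⟨hT, hq.1⟩, hq.2⟩
  refine ⟨fun T x => -∫ u in (0 : ℝ)..1, f₁ (T + u * (b - T)) x, ?_, fun T hT x hx => ?_⟩
  · have hT : ∀ T ∈ Icc a b, ∀ x ∈ Icc c d,
        HasDerivWithinAt (fun T => -∫ u in (0 : ℝ)..1, f₁ (T + u * (b - T)) x)
          (-∫ u in (0 : ℝ)..1, f₁₁ (T + u * (b - T)) x * (1 - u)) (Icc a b) T :=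
      fun T hT x hx => (hasDerivWithinAt_integral_of_partial zero_le_one
        (g := fun T u => f₁ (T + u * (b - T)) x)
        (g₁ := fun T u => f₁₁ (T + u * (b - T)) x * (1 - u))
        (fun T hT u hu => by
          refine (d₁₁ _ (mem hT hu) x hx).comp T ?_ fun s hs => mem hs hu
          exact ((hasDerivAt_id' T).fun_add (((hasDerivAt_id' T).const_sub b).const_mul
            u)).hasDerivWithinAt.congr_deriv (by ring))
        (contT c₁ hx) ((contT c₁₁ hx).mul (by fun_prop)) hT).neg
    have hx : ∀ T ∈ Icc a b, ∀ x ∈ Icc c d,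
        HasDerivWithinAt (fun x => -∫ u in (0 : ℝ)..1, f₁ (T + u * (b - T)) x)
          (-∫ u in (0 : ℝ)..1, f₁₂ (T + u * (b - T)) x) (Icc c d) x :=
      fun T hT x hx => (hasDerivWithinAt_integral_of_partial zero_le_one
        (g := fun x u => f₁ (T + u * (b - T)) x)
        (g₁ := fun x u => f₁₂ (T + u * (b - T)) x)
        (fun x hx u hu => d₁₂ _ (mem hT hu) x hx)
        (contx c₁ hT) (contx c₁₂ hT) hx).neg
    have := contDiffOn_succ_of_partials hab hcd (n := 0) hT hx
      (by
        simp only [CharP.cast_eq_zero, contDiffOn_zero]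
        exact (ContinuousOn.intervalIntegral_param zero_le_one (X := ℝ × ℝ)
          (k := fun p u => f₁₁ (p.1 + u * (b - p.1)) p.2 * (1 - u))
          ((cont c₁₁).mul (by fun_prop))).neg)
      (by
        simp only [CharP.cast_eq_zero, contDiffOn_zero]
        exact (ContinuousOn.intervalIntegral_param zero_le_one (X := ℝ × ℝ)
          (k := fun p u => f₁₂ (p.1 + u * (b - p.1)) p.2) (cont c₁₂)).neg)
    simpa using this
  · have key := intervalIntegral.integral_eq_sub_of_hasDerivAt_of_le (zero_le_one' ℝ)
      (f := fun u => f (T + u * (b - T)) x) (f' := fun u => f₁ (T + u * (b - T)) x * (b - T))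
      (fun u hu => by
        have h := (h₁ _ (mem hT hu) x hx).continuousWithinAt
        exact h.comp (f := fun u => T + u * (b - T)) (by fun_prop) fun v hv => mem hT hv)
      (fun u hu => by
        have hd : HasDerivWithinAt (fun u => T + u * (b - T)) (b - T) (Icc 0 1) u := by
          have := ((hasDerivAt_id u).mul_const (b - T)).const_add T
          simpa using this.hasDerivWithinAt
        have := (h₁ _ (mem hT (Ioo_subset_Icc_self hu)) x hx).comp u hd fun v hv => mem hT hv
        exact this.hasDerivAt (Icc_mem_nhds hu.1 hu.2))
      ((ContinuousOn.mul ((contx c₁ hT).comp (f := fun u => (x, u)) (by fun_prop)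
        fun u hu => ⟨hx, hu⟩) continuousOn_const).intervalIntegrable_of_Icc zero_le_one)
    simp only [intervalIntegral.integral_mul_const, one_mul, add_sub_cancel, zero_mul, add_zero,
      h0 x hx] at key
    linarith

end Division

section IntegralOperator

variable {a b c d : ℝ} {V V₁ k k₁ : ℝ → ℝ → ℝ}

lemma continuousOn_integral_mul (hcd : c ≤ d)
    (hV : ContinuousOn (fun p : ℝ × ℝ => V p.1 p.2) (Icc c d ×ˢ Icc c d))
    (hk : ContinuousOn (fun p : ℝ × ℝ => k p.1 p.2) (Icc a b ×ˢ Icc c d)) :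
    ContinuousOn (fun p : ℝ × ℝ => ∫ ξ in c..d, V p.2 ξ * k p.1 ξ) (Icc a b ×ˢ Icc c d) :=
  ContinuousOn.intervalIntegral_param hcd (X := ℝ × ℝ) (k := fun p ξ => V p.2 ξ * k p.1 ξ)
    ((hV.comp (f := fun q : (ℝ × ℝ) × ℝ => (q.1.2, q.2)) (by fun_prop)
      fun q hq => ⟨hq.1.2, hq.2⟩).mul
    (hk.comp (f := fun q : (ℝ × ℝ) × ℝ => (q.1.1, q.2)) (by fun_prop)
      fun q hq => ⟨hq.1.1, hq.2⟩))

lemma hasDerivWithinAt_integral_mul_left (hcd : c ≤ d)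
    (hV : ContinuousOn (fun p : ℝ × ℝ => V p.1 p.2) (Icc c d ×ˢ Icc c d))
    (hV₁ : ContinuousOn (fun p : ℝ × ℝ => V₁ p.1 p.2) (Icc c d ×ˢ Icc c d))
    (dV : ∀ x ∈ Icc c d, ∀ ξ ∈ Icc c d,
      HasDerivWithinAt (fun y => V y ξ) (V₁ x ξ) (Icc c d) x)
    (hk : ContinuousOn (fun p : ℝ × ℝ => k p.1 p.2) (Icc a b ×ˢ Icc c d)) :
    ∀ T ∈ Icc a b, ∀ x ∈ Icc c d,
      HasDerivWithinAt (fun y => ∫ ξ in c..d, V y ξ * k T ξ) (∫ ξ in c..d, V₁ x ξ * k T ξ)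
        (Icc c d) x := fun T hT x hx => by
  have hkT : ContinuousOn (fun p : ℝ × ℝ => k T p.2) (Icc c d ×ˢ Icc c d) :=
    hk.comp (f := fun p : ℝ × ℝ => (T, p.2)) (by fun_prop) fun p hp => ⟨hT, hp.2⟩
  exact hasDerivWithinAt_integral_of_partial hcd
    (g := fun y ξ => V y ξ * k T ξ) (g₁ := fun y ξ => V₁ y ξ * k T ξ)
    (fun y hy ξ hξ => (dV y hy ξ hξ).mul_const _) (hV.mul hkT) (hV₁.mul hkT) hx

lemma hasDerivWithinAt_integral_mul_right (hcd : c ≤ d)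
    (hV : ContinuousOn (fun p : ℝ × ℝ => V p.1 p.2) (Icc c d ×ˢ Icc c d))
    (hk : ContinuousOn (fun p : ℝ × ℝ => k p.1 p.2) (Icc a b ×ˢ Icc c d))
    (hk₁ : ContinuousOn (fun p : ℝ × ℝ => k₁ p.1 p.2) (Icc a b ×ˢ Icc c d))
    (dk : ∀ T ∈ Icc a b, ∀ ξ ∈ Icc c d,
      HasDerivWithinAt (fun s => k s ξ) (k₁ T ξ) (Icc a b) T) :
    ∀ T ∈ Icc a b, ∀ x ∈ Icc c d,
      HasDerivWithinAt (fun s => ∫ ξ in c..d, V x ξ * k s ξ) (∫ ξ in c..d, V x ξ * k₁ T ξ)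
        (Icc a b) T := fun T hT x hx => by
  have hVx : ContinuousOn (fun p : ℝ × ℝ => V x p.2) (Icc a b ×ˢ Icc c d) :=
    hV.comp (f := fun p : ℝ × ℝ => (x, p.2)) (by fun_prop) fun p hp => ⟨hx, hp.2⟩
  exact hasDerivWithinAt_integral_of_partial hcd
    (g := fun s ξ => V x ξ * k s ξ) (g₁ := fun s ξ => V x ξ * k₁ s ξ)
    (fun s hs ξ hξ => (dk s hs ξ hξ).const_mul _) (hVx.mul hk) (hVx.mul hk₁) hT

/-- The function `(T, x) ↦ ∫ V(x,ξ) k(T,ξ) dξ` is `C¹` when the kernels are `C¹` in their first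
variable. -/
lemma contDiffOn_one_integral_mul (hab : a < b) (hcd : c < d)
    (hV : ContDiffOn ℝ 1 (fun p : ℝ × ℝ => V p.1 p.2) (Icc c d ×ˢ Icc c d))
    (hk : ContDiffOn ℝ 1 (fun p : ℝ × ℝ => k p.1 p.2) (Icc a b ×ˢ Icc c d)) :
    ContDiffOn ℝ 1 (fun p : ℝ × ℝ => ∫ ξ in c..d, V p.2 ξ * k p.1 ξ) (Icc a b ×ˢ Icc c d) := by
  obtain ⟨V₁, -, cV₁, -, dV, -⟩ := exists_partials_of_contDiffOn_succ hcd hcd (n := 0)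
    (by simpa using hV)
  obtain ⟨k₁, -, ck₁, -, dk, -⟩ := exists_partials_of_contDiffOn_succ hab hcd (n := 0)
    (by simpa using hk)
  have := contDiffOn_succ_of_partials hab hcd (n := 0)
    (hasDerivWithinAt_integral_mul_right hcd.le hV.continuousOn hk.continuousOn
      ck₁.continuousOn dk)
    (hasDerivWithinAt_integral_mul_left hcd.le hV.continuousOn cV₁.continuousOn dV
      hk.continuousOn)
    (by simpa using continuousOn_integral_mul hcd.le hV.continuousOn ck₁.continuousOn)
    (by simpa using continuousOn_integral_mul hcd.le cV₁.continuousOn hk.continuousOn)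
  simpa using this

end IntegralOperator

/-- The quasi-particle energy `√(ξ² + f(T,ξ))`. -/
def quasiEnergy (f : ℝ → ℝ → ℝ) (T ξ : ℝ) : ℝ := √(ξ ^ 2 + f T ξ)

/-- The kernel `tanh(E/(2T)) / E` of the gap equation, `E` being the quasi-particle energy. -/
def gapKernel (f : ℝ → ℝ → ℝ) (T ξ : ℝ) : ℝ :=
  Real.tanh (quasiEnergy f T ξ / (2 * T)) / quasiEnergy f T ξ

namespace BCSContext

variable (C : BCSContext)

lemma T₀_pos : 0 < C.T₀ := C.htau₁pos.trans C.hT₀₁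

variable {C} in
lemma T_pos {T : ℝ} (hT : T ∈ Icc C.T₀ C.Tc) : 0 < T := C.T₀_pos.trans_le hT.1

variable {C} in
lemma energy_pos {x : ℝ} (hx : x ∈ Icc C.eps C.om) : 0 < x := C.heps.trans_le hx.1

lemma Umin_pos : 0 < C.Umin := by
  obtain ⟨x, hx, y, hy, h⟩ := C.hUmin.1
  exact h ▸ C.hU₁pos.trans_le (C.hUlb x hx y hy)

lemma Umin_le_Umax : C.Umin ≤ C.Umax := C.hUmin.2 C.hUmax.1

lemma one_le_a : 1 ≤ C.a := by
  rw [C.ha]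
  exact one_le_pow₀ ((one_le_div C.Umin_pos).2 C.Umin_le_Umax)

end BCSContext

/-- The data extracted from a function `f ∈ W`: the `C¹` quotient `h = f / (T_c - T)`, the
derivative `f₁ = ∂f/∂T`, the derivative `k₁` of the kernel, and their properties. -/
structure IsFactorization (C : BCSContext) (f h f₁ k₁ : ℝ → ℝ → ℝ) : Prop where
  nonneg : ∀ T ∈ Icc C.T₀ C.Tc, ∀ x ∈ Icc C.eps C.om, 0 ≤ f T x
  le : ∀ T ∈ Icc C.T₀ C.Tc, ∀ x ∈ Icc C.eps C.om, f T x ≤ C.Δ₂ T ^ 2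
  eq : ∀ T ∈ Icc C.T₀ C.Tc, ∀ x ∈ Icc C.eps C.om, f T x = (C.Tc - T) * h T x
  pos : ∀ T ∈ Icc C.T₀ C.Tc, ∀ x ∈ Icc C.eps C.om, 0 < h T x
  ratio : ∀ T ∈ Icc C.T₀ C.Tc, ∀ x ∈ Icc C.eps C.om, ∀ y ∈ Icc C.eps C.om,
    h T x ≤ C.a * h T y
  contDiffOn : ContDiffOn ℝ 1 (fun p : ℝ × ℝ => h p.1 p.2) (Icc C.T₀ C.Tc ×ˢ Icc C.eps C.om)
  hasDeriv : ∀ T ∈ Icc C.T₀ C.Tc, ∀ x ∈ Icc C.eps C.om,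
    HasDerivWithinAt (fun s => f s x) (f₁ T x) (Icc C.T₀ C.Tc) T
  contDiffOn_deriv : ContDiffOn ℝ 1 (fun p : ℝ × ℝ => f₁ p.1 p.2)
    (Icc C.T₀ C.Tc ×ˢ Icc C.eps C.om)
  deriv_neg : ∀ T ∈ Icc C.T₀ C.Tc, ∀ x ∈ Icc C.eps C.om, f₁ T x < 0
  neg_deriv_le : ∀ T ∈ Icc C.T₀ C.Tc, ∀ x ∈ Icc C.eps C.om, -f₁ T x ≤ C.MT
  contDiffOn_kernel : ContDiffOn ℝ 1 (fun p : ℝ × ℝ => gapKernel f p.1 p.2)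
    (Icc C.T₀ C.Tc ×ˢ Icc C.eps C.om)
  contDiffOn_kernel_deriv : ContDiffOn ℝ 1 (fun p : ℝ × ℝ => k₁ p.1 p.2)
    (Icc C.T₀ C.Tc ×ˢ Icc C.eps C.om)
  hasDeriv_kernel : ∀ T ∈ Icc C.T₀ C.Tc, ∀ x ∈ Icc C.eps C.om,
    HasDerivWithinAt (fun s => gapKernel f s x) (k₁ T x) (Icc C.T₀ C.Tc) T

section Kernel

variable {C : BCSContext} {f f₁ : ℝ → ℝ → ℝ}

lemma contDiffOn_gapKernel {n : WithTop ℕ∞}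
    (hf : ContDiffOn ℝ n (fun p : ℝ × ℝ => f p.1 p.2) (Icc C.T₀ C.Tc ×ˢ Icc C.eps C.om))
    (h0 : ∀ T ∈ Icc C.T₀ C.Tc, ∀ x ∈ Icc C.eps C.om, 0 ≤ f T x) :
    ContDiffOn ℝ n (fun p : ℝ × ℝ => gapKernel f p.1 p.2)
      (Icc C.T₀ C.Tc ×ˢ Icc C.eps C.om) := by
  have pos : ∀ p ∈ Icc C.T₀ C.Tc ×ˢ Icc C.eps C.om, 0 < p.2 ^ 2 + f p.1 p.2 := fun p hp => by
    have := C.energy_pos hp.2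
    have := h0 p.1 hp.1 p.2 hp.2
    positivity
  have hE : ContDiffOn ℝ n (fun p : ℝ × ℝ => √(p.2 ^ 2 + f p.1 p.2))
      (Icc C.T₀ C.Tc ×ˢ Icc C.eps C.om) :=
    ((contDiff_snd.pow 2).contDiffOn.add hf).sqrt fun p hp => (pos p hp).ne'
  have hη : ContDiffOn ℝ n (fun p : ℝ × ℝ => √(p.2 ^ 2 + f p.1 p.2) / (2 * p.1))
      (Icc C.T₀ C.Tc ×ˢ Icc C.eps C.om) :=
    hE.div (contDiff_const.mul contDiff_fst).contDiffOn fun p hp => by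
      have := C.T_pos hp.1
      positivity
  exact (Real.contDiff_tanh.comp_contDiffOn hη).div hE fun p hp => (Real.sqrt_pos.2 (pos p hp)).ne'

lemma quasiEnergy_sq {T x : ℝ} (h : 0 ≤ f T x) : quasiEnergy f T x ^ 2 = x ^ 2 + f T x :=
  Real.sq_sqrt (by positivity)

lemma le_quasiEnergy {T x : ℝ} (h : 0 ≤ f T x) : x ≤ quasiEnergy f T x :=
  Real.le_sqrt_of_sq_le (by linarith)

lemma quasiEnergy_pos {T x : ℝ} (hx : 0 < x) (h : 0 ≤ f T x) : 0 < quasiEnergy f T x :=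
  hx.trans_le (le_quasiEnergy h)

lemma gapKernel_pos {T x : ℝ} (hT : 0 < T) (hx : 0 < x) (h : 0 ≤ f T x) : 0 < gapKernel f T x :=
  div_pos (Real.tanh_pos (div_pos (quasiEnergy_pos hx h) (by positivity))) (quasiEnergy_pos hx h)

lemma hasDerivWithinAt_gapKernel {s : Set ℝ} {T x D : ℝ} (hT : 0 < T) (hx : 0 < x)
    (h : 0 ≤ f T x) (hd : HasDerivWithinAt (fun s => f s x) D s T) :
    HasDerivWithinAt (fun s => gapKernel f s x)
      (-D / (2 * quasiEnergy f T x ^ 3) * (Real.tanh (quasiEnergy f T x / (2 * T))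
        - quasiEnergy f T x / (2 * T) / Real.cosh (quasiEnergy f T x / (2 * T)) ^ 2)
        - 1 / (2 * T ^ 2 * Real.cosh (quasiEnergy f T x / (2 * T)) ^ 2)) s T := by
  have hE := quasiEnergy_pos hx h
  have dE : HasDerivWithinAt (fun s => quasiEnergy f s x) (D / (2 * quasiEnergy f T x)) s T :=
    (hd.const_add (x ^ 2)).sqrt (by positivity)
  have dη := dE.fun_div ((hasDerivWithinAt_id T s).const_mul 2) (by simpa using hT.ne')
  have dt := (Real.hasDerivAt_tanh _).comp_hasDerivWithinAt T dη
  refine (dt.fun_div dE hE.ne').congr_deriv ?_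
  have hc := (Real.cosh_pos (quasiEnergy f T x / (2 * T))).ne'
  simp only [id, Function.comp]
  generalize Real.cosh (quasiEnergy f T x / (2 * T)) = c at *
  generalize Real.tanh (quasiEnergy f T x / (2 * T)) = t at *
  field_simp
  ring

end Kernel

lemma memW.exists_isFactorization {C : BCSContext} {f : ℝ → ℝ → ℝ} (hf : memW C f) :
    ∃ h f₁ k₁, IsFactorization C f h f₁ k₁ := by
  obtain ⟨hC, hΔ, h0, hr, hr', hneg, hM⟩ := hf
  have two : ((1 : ℕ) : WithTop ℕ∞) + 1 = 2 := by norm_num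
  have hlt := C.hT₀₂
  have hI := C.hepsom
  have huniq : ∀ T ∈ Icc C.T₀ C.Tc, UniqueDiffWithinAt ℝ (Icc C.T₀ C.Tc) T :=
    uniqueDiffOn_Icc hlt
  have hTc : C.Tc ∈ Icc C.T₀ C.Tc := right_mem_Icc.2 hlt.le
  have nonneg : ∀ T ∈ Icc C.T₀ C.Tc, ∀ x ∈ Icc C.eps C.om, 0 ≤ f T x := fun T hT x hx =>
    (sq_nonneg _).trans (hΔ T hT x hx).1
  obtain ⟨f₁, -, cf₁, -, df₁, -⟩ := exists_partials_of_contDiffOn_succ hlt hI (n := 1)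
    (g := f) (by rw [two]; exact hC)
  have pd : ∀ T ∈ Icc C.T₀ C.Tc, ∀ x ∈ Icc C.eps C.om, pderivT C f T x = f₁ T x :=
    fun T hT x hx => (df₁ T hT x hx).derivWithin (huniq T hT)
  have neg : ∀ T ∈ Icc C.T₀ C.Tc, ∀ x ∈ Icc C.eps C.om, f₁ T x < 0 := fun T hT x hx =>
    pd T hT x hx ▸ hneg T hT x hx
  obtain ⟨h, ch, eq⟩ := exists_eq_sub_mul_of_contDiffOn hlt hI df₁ (by simpa using cf₁) h0
  have ck := contDiffOn_gapKernel (C := C) hC nonneg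
  obtain ⟨k₁, -, ck₁, -, dk₁, -⟩ := exists_partials_of_contDiffOn_succ hlt hI (n := 1)
    (by rw [two]; exact ck)
  have hend : ∀ x ∈ Icc C.eps C.om, h C.Tc x = -f₁ C.Tc x := fun x hx => by
    obtain ⟨h₁, -, -, -, dh, -⟩ := exists_partials_of_contDiffOn_succ hlt hI (n := 0)
      (by simpa using ch)
    have d := ((hasDerivWithinAt_id C.Tc (Icc C.T₀ C.Tc)).const_sub C.Tc).fun_mul (dh _ hTc x hx)
    have := (huniq _ hTc).eq_deriv _ (d.congr (fun s hs => eq s hs x hx) (eq _ hTc x hx))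
      (df₁ _ hTc x hx)
    simp at this
    linarith
  have fpos : ∀ T ∈ Ico C.T₀ C.Tc, ∀ x ∈ Icc C.eps C.om, 0 < f T x := fun T hT x hx => by
    have anti := strictAntiOn_of_hasDerivWithinAt_neg (convex_Icc C.T₀ C.Tc)
      (fun s hs => (df₁ s hs x hx).continuousWithinAt)
      (fun s hs => (df₁ s (interior_subset hs) x hx).mono interior_subset)
      (fun s hs => neg s (interior_subset hs) x hx)
    simpa [h0 x hx] using anti (Ico_subset_Icc_self hT) hTc hT.2
  have cases : ∀ T ∈ Icc C.T₀ C.Tc, T = C.Tc ∨ T ∈ Ico C.T₀ C.Tc := fun T hT =>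
    hT.2.eq_or_lt.imp id fun h => ⟨hT.1, h⟩
  refine ⟨h, f₁, k₁, nonneg, fun T hT x hx => (hΔ T hT x hx).2, eq, fun T hT x hx => ?_,
    fun T hT x hx y hy => ?_, ch, df₁, by simpa using cf₁, neg,
    fun T hT x hx => pd T hT x hx ▸ hM T hT x hx, ck.of_le (by norm_num), by simpa using ck₁, dk₁⟩
  · rcases cases T hT with rfl | hT'
    · linarith [hend x hx, neg _ hT x hx]
    · have := fpos T hT' x hx
      rw [eq T hT x hx] at this
      exact pos_of_mul_pos_right this (by linarith [hT.2])
  · rcases cases T hT with rfl | hT'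
    · have := hr' x hx y hy
      rwa [pd _ hTc x hx, pd _ hTc y hy, ← hend x hx, ← hend y hy] at this
    · have := hr T hT' x hx y hy
      rw [eq T hT x hx, eq T hT y hy] at this
      have pos : 0 < C.Tc - T := by linarith [hT'.2]
      exact le_of_mul_le_mul_left (by linarith) pos

namespace IsFactorization

variable {C : BCSContext} {f h f₁ k₁ : ℝ → ℝ → ℝ}

lemma continuousOn_U : ContinuousOn (fun p : ℝ × ℝ => C.U p.1 p.2)
    (Icc C.eps C.om ×ˢ Icc C.eps C.om) := C.hUsmooth.continuousOn

lemma continuousOn_U_slice {x : ℝ} (hx : x ∈ Icc C.eps C.om) :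
    ContinuousOn (fun ξ => C.U x ξ) (Icc C.eps C.om) := continuousOn_U.slice_snd hx

lemma U_pos {x ξ : ℝ} (hx : x ∈ Icc C.eps C.om) (hξ : ξ ∈ Icc C.eps C.om) : 0 < C.U x ξ :=
  C.hU₁pos.trans_le (C.hUlb x hx ξ hξ)

/-- The integrand `√h · k` of the operator divided by `√(T_c - T)`. -/
def reducedKernel (f h : ℝ → ℝ → ℝ) (T ξ : ℝ) : ℝ := √(h T ξ) * gapKernel f T ξ

/-- The kernel whose product with `reducedKernel` gives `-∂(Af)/∂T`. -/
def derivKernel (C : BCSContext) (f h f₁ k₁ : ℝ → ℝ → ℝ) (T ξ : ℝ) : ℝ :=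
  -f₁ T ξ / √(h T ξ) * gapKernel f T ξ - 2 * (C.Tc - T) * (√(h T ξ) * k₁ T ξ)

section Regularity

variable (H : IsFactorization C f h f₁ k₁)
include H

lemma contDiffOn_sqrt : ContDiffOn ℝ 1 (fun p : ℝ × ℝ => √(h p.1 p.2))
    (Icc C.T₀ C.Tc ×ˢ Icc C.eps C.om) :=
  H.contDiffOn.sqrt fun p hp => (H.pos p.1 hp.1 p.2 hp.2).ne'

lemma contDiffOn_reducedKernel : ContDiffOn ℝ 1 (fun p : ℝ × ℝ => reducedKernel f h p.1 p.2)
    (Icc C.T₀ C.Tc ×ˢ Icc C.eps C.om) :=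
  H.contDiffOn_sqrt.mul H.contDiffOn_kernel

lemma contDiffOn_derivKernel :
    ContDiffOn ℝ 1 (fun p : ℝ × ℝ => derivKernel C f h f₁ k₁ p.1 p.2)
      (Icc C.T₀ C.Tc ×ˢ Icc C.eps C.om) :=
  ((H.contDiffOn_deriv.neg.div H.contDiffOn_sqrt fun p hp =>
    (Real.sqrt_pos.2 (H.pos p.1 hp.1 p.2 hp.2)).ne').mul H.contDiffOn_kernel).sub
    ((contDiff_const.mul (contDiff_const.sub contDiff_fst)).contDiffOn.mul
      (H.contDiffOn_sqrt.mul H.contDiffOn_kernel_deriv))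

lemma reducedKernel_pos {T ξ : ℝ} (hT : T ∈ Icc C.T₀ C.Tc) (hξ : ξ ∈ Icc C.eps C.om) :
    0 < reducedKernel f h T ξ :=
  mul_pos (Real.sqrt_pos.2 (H.pos T hT ξ hξ))
    (gapKernel_pos (C.T_pos hT) (C.energy_pos hξ) (H.nonneg T hT ξ hξ))

lemma intervalIntegrable_reducedKernel {T x : ℝ} (hT : T ∈ Icc C.T₀ C.Tc)
    (hx : x ∈ Icc C.eps C.om) :
    IntervalIntegrable (fun ξ => C.U x ξ * reducedKernel f h T ξ) volume C.eps C.om :=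
  ((continuousOn_U_slice hx).mul
    (H.contDiffOn_reducedKernel.continuousOn.slice_snd hT)).intervalIntegrable_of_Icc C.hepsom.le

lemma intervalIntegrable_derivKernel {T x : ℝ} (hT : T ∈ Icc C.T₀ C.Tc)
    (hx : x ∈ Icc C.eps C.om) :
    IntervalIntegrable (fun ξ => C.U x ξ * derivKernel C f h f₁ k₁ T ξ) volume C.eps C.om :=
  ((continuousOn_U_slice hx).mul
    (H.contDiffOn_derivKernel.continuousOn.slice_snd hT)).intervalIntegrable_of_Icc C.hepsom.le

lemma integral_reducedKernel_pos {T x : ℝ} (hT : T ∈ Icc C.T₀ C.Tc) (hx : x ∈ Icc C.eps C.om) :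
    0 < ∫ ξ in C.eps..C.om, C.U x ξ * reducedKernel f h T ξ :=
  intervalIntegral.intervalIntegral_pos_of_pos_on (H.intervalIntegrable_reducedKernel hT hx)
    (fun _ hξ => mul_pos (U_pos hx (Ioo_subset_Icc_self hξ))
      (H.reducedKernel_pos hT (Ioo_subset_Icc_self hξ))) C.hepsom

lemma opA_eq {T : ℝ} (hT : T ∈ Icc C.T₀ C.Tc) (x : ℝ) :
    opA C f T x = (C.Tc - T) * (∫ ξ in C.eps..C.om, C.U x ξ * reducedKernel f h T ξ) ^ 2 := by
  have h0 : 0 ≤ C.Tc - T := sub_nonneg.2 hT.2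
  have e : ∫ ξ in C.eps..C.om, C.U x ξ * √(f T ξ / (ξ ^ 2 + f T ξ)) *
        Real.tanh (√(ξ ^ 2 + f T ξ) / (2 * T))
      = √(C.Tc - T) * ∫ ξ in C.eps..C.om, C.U x ξ * reducedKernel f h T ξ := by
    rw [← intervalIntegral.integral_const_mul]
    refine intervalIntegral.integral_congr fun ξ hξ => ?_
    rw [uIcc_of_le C.hepsom.le] at hξ
    simp only [reducedKernel, gapKernel, quasiEnergy]
    rw [Real.sqrt_div (H.nonneg T hT ξ hξ)]
    nth_rewrite 1 [H.eq T hT ξ hξ]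
    rw [Real.sqrt_mul h0]
    ring
  rw [opA, e, mul_pow, Real.sq_sqrt h0]

lemma hasDerivWithinAt_reducedKernel : ∃ p₁ : ℝ → ℝ → ℝ,
    ContinuousOn (fun p : ℝ × ℝ => p₁ p.1 p.2) (Icc C.T₀ C.Tc ×ˢ Icc C.eps C.om) ∧
    (∀ T ∈ Icc C.T₀ C.Tc, ∀ ξ ∈ Icc C.eps C.om,
      HasDerivWithinAt (fun s => reducedKernel f h s ξ) (p₁ T ξ) (Icc C.T₀ C.Tc) T) ∧
    ∀ T ∈ Icc C.T₀ C.Tc, ∀ ξ ∈ Icc C.eps C.om,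
      derivKernel C f h f₁ k₁ T ξ = reducedKernel f h T ξ - 2 * (C.Tc - T) * p₁ T ξ := by
  obtain ⟨h₁, -, ch₁, -, dh, -⟩ := exists_partials_of_contDiffOn_succ C.hT₀₂ C.hepsom (n := 0)
    (by simpa using H.contDiffOn)
  have cs := H.contDiffOn_sqrt.continuousOn
  have ck := H.contDiffOn_kernel.continuousOn
  have ck₁ := H.contDiffOn_kernel_deriv.continuousOn
  refine ⟨fun T ξ => h₁ T ξ / (2 * √(h T ξ)) * gapKernel f T ξ + √(h T ξ) * k₁ T ξ,
    ((ch₁.continuousOn.div (continuousOn_const.mul cs) fun p hp => ?_).mul ck).add (cs.mul ck₁),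
    fun T hT ξ hξ => ?_, fun T hT ξ hξ => ?_⟩
  · exact mul_ne_zero two_ne_zero (Real.sqrt_pos.2 (H.pos p.1 hp.1 p.2 hp.2)).ne'
  · exact ((dh T hT ξ hξ).sqrt (H.pos T hT ξ hξ).ne').fun_mul (H.hasDeriv_kernel T hT ξ hξ)
  · have d := ((hasDerivWithinAt_id T (Icc C.T₀ C.Tc)).const_sub C.Tc).fun_mul (dh T hT ξ hξ)
    have e := (uniqueDiffOn_Icc C.hT₀₂ T hT).eq_deriv _
      (d.congr (fun s hs => H.eq s hs ξ hξ) (H.eq T hT ξ hξ)) (H.hasDeriv T hT ξ hξ)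
    have hs := Real.sqrt_pos.2 (H.pos T hT ξ hξ)
    have hs2 := Real.sq_sqrt (H.pos T hT ξ hξ).le
    simp only [id, neg_mul, one_mul] at e
    simp only [derivKernel, reducedKernel]
    rw [← e]
    field_simp
    rw [hs2]
    ring

lemma hasDerivWithinAt_opA {T x : ℝ} (hT : T ∈ Icc C.T₀ C.Tc) (hx : x ∈ Icc C.eps C.om) :
    HasDerivWithinAt (fun s => opA C f s x)
      (-((∫ ξ in C.eps..C.om, C.U x ξ * reducedKernel f h T ξ) *
        ∫ ξ in C.eps..C.om, C.U x ξ * derivKernel C f h f₁ k₁ T ξ)) (Icc C.T₀ C.Tc) T := by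
  obtain ⟨p₁, cp₁, dp, hp⟩ := H.hasDerivWithinAt_reducedKernel
  have dJ := hasDerivWithinAt_integral_mul_right C.hepsom.le continuousOn_U
    H.contDiffOn_reducedKernel.continuousOn cp₁ dp T hT x hx
  have int₁ : IntervalIntegrable (fun ξ => C.U x ξ * p₁ T ξ) volume C.eps C.om :=
    ((continuousOn_U_slice hx).mul (cp₁.slice_snd hT)).intervalIntegrable_of_Icc C.hepsom.le
  have e : ∫ ξ in C.eps..C.om, C.U x ξ * derivKernel C f h f₁ k₁ T ξ
      = (∫ ξ in C.eps..C.om, C.U x ξ * reducedKernel f h T ξ)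
        - 2 * (C.Tc - T) * ∫ ξ in C.eps..C.om, C.U x ξ * p₁ T ξ := by
    rw [← intervalIntegral.integral_const_mul, ← intervalIntegral.integral_sub
      (H.intervalIntegrable_reducedKernel hT hx) (int₁.const_mul _)]
    refine intervalIntegral.integral_congr fun ξ hξ => ?_
    rw [uIcc_of_le C.hepsom.le] at hξ
    simp only [hp T hT ξ hξ]
    ring
  have d := ((hasDerivWithinAt_id T (Icc C.T₀ C.Tc)).const_sub C.Tc).fun_mul (dJ.fun_pow 2)
  refine (d.congr (fun s hs => H.opA_eq hs x) (H.opA_eq hT x)).congr_deriv ?_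
  rw [e]
  simp only [id]
  push_cast
  ring

lemma contDiffOn_opA : ContDiffOn ℝ 2 (fun p : ℝ × ℝ => opA C f p.1 p.2)
    (Icc C.T₀ C.Tc ×ˢ Icc C.eps C.om) := by
  have two : ((1 : ℕ) : WithTop ℕ∞) + 1 = 2 := by norm_num
  have hlt := C.hT₀₂
  have hI := C.hepsom
  obtain ⟨U₁, -, cU₁, -, dU, -⟩ := exists_partials_of_contDiffOn_succ hI hI (n := 1) (g := C.U)
    (by rw [two]; exact C.hUsmooth)
  rw [Nat.cast_one] at cU₁
  have cU : ContDiffOn ℝ 1 (fun p : ℝ × ℝ => C.U p.1 p.2) (Icc C.eps C.om ×ˢ Icc C.eps C.om) :=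
    C.hUsmooth.of_le (by norm_num)
  have J := contDiffOn_one_integral_mul hlt hI cU H.contDiffOn_reducedKernel
  have J' := contDiffOn_one_integral_mul hlt hI cU H.contDiffOn_derivKernel
  have J₁ := contDiffOn_one_integral_mul hlt hI cU₁ H.contDiffOn_reducedKernel
  have dx := hasDerivWithinAt_integral_mul_left hI.le cU.continuousOn cU₁.continuousOn dU
    H.contDiffOn_reducedKernel.continuousOn
  have hx : ∀ T ∈ Icc C.T₀ C.Tc, ∀ x ∈ Icc C.eps C.om,
      HasDerivWithinAt (fun y => opA C f T y)
        ((C.Tc - T) * (2 * (∫ ξ in C.eps..C.om, C.U x ξ * reducedKernel f h T ξ) *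
          ∫ ξ in C.eps..C.om, U₁ x ξ * reducedKernel f h T ξ)) (Icc C.eps C.om) x :=
    fun T hT x hx => by
      have d := ((dx T hT x hx).fun_pow 2).const_mul (C.Tc - T)
      refine (d.congr (fun y _ => H.opA_eq hT y) (H.opA_eq hT x)).congr_deriv ?_
      push_cast
      ring
  rw [← two]
  refine contDiffOn_succ_of_partials hlt hI (fun T hT x hx => H.hasDerivWithinAt_opA hT hx) hx
    ?_ ?_
  · rw [Nat.cast_one]
    exact (J.mul J').neg
  · rw [Nat.cast_one]
    exact (contDiff_const.sub contDiff_fst).contDiffOn.mul ((contDiffOn_const.mul J).mul J₁)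

end Regularity

end IsFactorization

namespace BCSContext

variable (C : BCSContext)

variable {C} in
lemma Δ₂_le {T : ℝ} (hT : T ∈ Icc C.T₀ C.Tc) : C.Δ₂ T ≤ C.Δ₂ 0 :=
  C.hΔ₂anti.antitoneOn ⟨le_rfl, C.htau₂pos.le⟩ ⟨(C.T_pos hT).le, hT.2.trans C.hTc₂⟩ (C.T_pos hT).le

lemma Tc_pos : 0 < C.Tc := C.T₀_pos.trans C.hT₀₂

lemma intervalIntegrable_rpow : IntervalIntegrable
    (fun ξ : ℝ => (ξ ^ 2 + C.Δ₂ 0 ^ 2) ^ (-(3 : ℝ) / 2)) volume C.eps C.om := by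
  refine ContinuousOn.intervalIntegrable_of_Icc C.hepsom.le ?_
  refine ContinuousOn.rpow_const (by fun_prop) fun ξ hξ => Or.inl ?_
  have := C.energy_pos hξ
  positivity

lemma integral_rpow_pos :
    0 < ∫ ξ in C.eps..C.om, (ξ ^ 2 + C.Δ₂ 0 ^ 2) ^ (-(3 : ℝ) / 2) :=
  intervalIntegral.intervalIntegral_pos_of_pos_on C.intervalIntegrable_rpow (fun ξ hξ => by
    have := C.energy_pos (Ioo_subset_Icc_self hξ)
    positivity) C.hepsom

lemma MT_mul_eq : C.MT * (C.eps * C.U₁ *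
    (Real.tanh (C.eps / (2 * C.Tc)) -
      (C.eps / (2 * C.Tc)) / Real.cosh (C.eps / (2 * C.Tc)) ^ 2) *
    ∫ ξ in C.eps..C.om, (ξ ^ 2 + C.Δ₂ 0 ^ 2) ^ (-(3 : ℝ) / 2)) =
    4 * C.a * C.U₂ * C.Mz ^ 2 := by
  rw [C.hMT]
  refine div_mul_cancel₀ _ (ne_of_gt ?_)
  have h1 := Real.tanh_sub_div_cosh_sq_pos
    (div_pos C.heps (mul_pos two_pos C.Tc_pos) : 0 < C.eps / (2 * C.Tc))
  have h2 := C.integral_rpow_pos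
  have h3 := C.heps
  have h4 := C.hU₁pos
  positivity

lemma intervalIntegrable_one_div_sq :
    IntervalIntegrable (fun ξ : ℝ => 1 / ξ ^ 2) volume C.eps C.om := by
  refine ContinuousOn.intervalIntegrable_of_Icc C.hepsom.le ?_
  refine continuousOn_const.div (by fun_prop) fun ξ hξ => ?_
  have := C.energy_pos hξ
  positivity

lemma integral_one_div_sq_le : ∫ ξ in C.eps..C.om, 1 / ξ ^ 2 ≤ 1 / C.eps := by
  have key := intervalIntegral.integral_eq_sub_of_hasDerivAt (a := C.eps) (b := C.om)
    (f := fun ξ : ℝ => -ξ⁻¹) (f' := fun ξ => 1 / ξ ^ 2) (fun ξ hξ => by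
      rw [uIcc_of_le C.hepsom.le] at hξ
      refine (hasDerivAt_inv (C.energy_pos hξ).ne').fun_neg.congr_deriv ?_
      rw [neg_neg, one_div]) C.intervalIntegrable_one_div_sq
  rw [key, one_div]
  have := inv_pos.2 (C.heps.trans C.hepsom)
  linarith

end BCSContext

namespace IsFactorization

variable {C : BCSContext} {f h f₁ k₁ : ℝ → ℝ → ℝ}

section Bounds

variable (H : IsFactorization C f h f₁ k₁)
include H

lemma derivKernel_eq {T ξ : ℝ} (hT : T ∈ Icc C.T₀ C.Tc) (hξ : ξ ∈ Icc C.eps C.om) :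
    derivKernel C f h f₁ k₁ T ξ =
      -f₁ T ξ * (gapKernel f T ξ / √(h T ξ) - (C.Tc - T) * √(h T ξ) *
        (Real.tanh (quasiEnergy f T ξ / (2 * T)) - quasiEnergy f T ξ / (2 * T) /
          Real.cosh (quasiEnergy f T ξ / (2 * T)) ^ 2) / quasiEnergy f T ξ ^ 3) +
      (C.Tc - T) * √(h T ξ) / (T ^ 2 * Real.cosh (quasiEnergy f T ξ / (2 * T)) ^ 2) := by
  have hk := (uniqueDiffOn_Icc C.hT₀₂ T hT).eq_deriv _ (H.hasDeriv_kernel T hT ξ hξ)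
    (hasDerivWithinAt_gapKernel (C.T_pos hT) (C.energy_pos hξ) (H.nonneg T hT ξ hξ)
      (H.hasDeriv T hT ξ hξ))
  have hE := quasiEnergy_pos (C.energy_pos hξ) (H.nonneg T hT ξ hξ)
  have hc := Real.cosh_pos (quasiEnergy f T ξ / (2 * T))
  have hT0 := C.T_pos hT
  rw [derivKernel, hk]
  generalize Real.tanh (quasiEnergy f T ξ / (2 * T)) - quasiEnergy f T ξ / (2 * T) /
          Real.cosh (quasiEnergy f T ξ / (2 * T)) ^ 2 = m
  generalize Real.cosh (quasiEnergy f T ξ / (2 * T)) = c at *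
  have hs := Real.sqrt_pos.2 (H.pos T hT ξ hξ)
  field_simp
  ring

lemma main_factor_pos {T ξ : ℝ} (hT : T ∈ Icc C.T₀ C.Tc) (hξ : ξ ∈ Icc C.eps C.om) :
    0 < gapKernel f T ξ / √(h T ξ) - (C.Tc - T) * √(h T ξ) *
        (Real.tanh (quasiEnergy f T ξ / (2 * T)) - quasiEnergy f T ξ / (2 * T) /
          Real.cosh (quasiEnergy f T ξ / (2 * T)) ^ 2) / quasiEnergy f T ξ ^ 3 := by
  have hξ0 := C.energy_pos hξ
  have hT0 := C.T_pos hT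
  have hf0 := H.nonneg T hT ξ hξ
  have hE := quasiEnergy_pos hξ0 hf0
  have hE2 := quasiEnergy_sq hf0
  have hη : 0 < quasiEnergy f T ξ / (2 * T) := by positivity
  have ht := Real.tanh_pos hη
  have hc := Real.cosh_pos (quasiEnergy f T ξ / (2 * T))
  have hs := Real.sqrt_pos.2 (H.pos T hT ξ hξ)
  have hs2 := Real.sq_sqrt (H.pos T hT ξ hξ).le
  have e : gapKernel f T ξ / √(h T ξ) - (C.Tc - T) * √(h T ξ) *
        (Real.tanh (quasiEnergy f T ξ / (2 * T)) - quasiEnergy f T ξ / (2 * T) /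
          Real.cosh (quasiEnergy f T ξ / (2 * T)) ^ 2) / quasiEnergy f T ξ ^ 3 =
      (ξ ^ 2 * Real.tanh (quasiEnergy f T ξ / (2 * T)) + f T ξ * (quasiEnergy f T ξ / (2 * T) /
          Real.cosh (quasiEnergy f T ξ / (2 * T)) ^ 2)) /
        (quasiEnergy f T ξ ^ 3 * √(h T ξ)) := by
    rw [gapKernel, eq_sub_of_add_eq hE2.symm, H.eq T hT ξ hξ]
    generalize Real.tanh (quasiEnergy f T ξ / (2 * T)) = t at *
    generalize quasiEnergy f T ξ / (2 * T) / Real.cosh (quasiEnergy f T ξ / (2 * T)) ^ 2 = u at *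
    field_simp
    rw [hs2]
    ring
  rw [e]
  positivity

lemma derivKernel_pos {T ξ : ℝ} (hT : T ∈ Icc C.T₀ C.Tc) (hξ : ξ ∈ Icc C.eps C.om) :
    0 < derivKernel C f h f₁ k₁ T ξ := by
  rw [H.derivKernel_eq hT hξ]
  have h1 := H.main_factor_pos hT hξ
  have h2 : 0 < -f₁ T ξ := neg_pos.2 (H.deriv_neg T hT ξ hξ)
  have h3 : 0 ≤ C.Tc - T := sub_nonneg.2 hT.2
  exact add_pos_of_pos_of_nonneg (mul_pos h2 h1) (by positivity)

lemma MT_pos : 0 < C.MT := by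
  have hT : C.T₀ ∈ Icc C.T₀ C.Tc := left_mem_Icc.2 C.hT₀₂.le
  have hx : C.eps ∈ Icc C.eps C.om := left_mem_Icc.2 C.hepsom.le
  linarith [H.deriv_neg _ hT _ hx, H.neg_deriv_le _ hT _ hx]

lemma sqrt_le {T x y : ℝ} (hT : T ∈ Icc C.T₀ C.Tc) (hx : x ∈ Icc C.eps C.om)
    (hy : y ∈ Icc C.eps C.om) : √(h T x) ≤ √C.a * √(h T y) := by
  rw [← Real.sqrt_mul (by linarith [C.one_le_a])]
  exact Real.sqrt_le_sqrt (H.ratio T hT x hx y hy)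

lemma quasiEnergy_sq_le {T ξ : ℝ} (hT : T ∈ Icc C.T₀ C.Tc) (hξ : ξ ∈ Icc C.eps C.om) :
    quasiEnergy f T ξ ^ 2 ≤ ξ ^ 2 + C.Δ₂ 0 ^ 2 := by
  rw [quasiEnergy_sq (H.nonneg T hT ξ hξ)]
  have h2 := pow_le_pow_left₀ (C.hΔ₂nonneg T) (C.Δ₂_le hT) 2
  linarith [H.le T hT ξ hξ]

lemma remainder_le {T x ξ : ℝ} (hT : T ∈ Icc C.T₀ C.Tc) (hx : x ∈ Icc C.eps C.om)
    (hξ : ξ ∈ Icc C.eps C.om) :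
    C.U x ξ * derivKernel C f h f₁ k₁ T ξ ≤
      C.MT * (C.U x ξ * (gapKernel f T ξ / √(h T ξ))) +
      (C.Tc - T) * √(h T C.eps) * (4 * C.Mz ^ 2 * C.U₂ * √C.a * (1 / ξ ^ 2) -
        C.MT * C.U₁ * (Real.tanh (C.eps / (2 * C.Tc)) -
          (C.eps / (2 * C.Tc)) / Real.cosh (C.eps / (2 * C.Tc)) ^ 2) / √C.a *
          (ξ ^ 2 + C.Δ₂ 0 ^ 2) ^ (-(3 : ℝ) / 2)) := by
  have hξ0 := C.energy_pos hξ
  have hT0 := C.T_pos hT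
  have hTc0 := C.Tc_pos
  have hf0 := H.nonneg T hT ξ hξ
  have hE := quasiEnergy_pos hξ0 hf0
  have hEξ := le_quasiEnergy hf0
  have heps0 := C.heps
  have hepsI : C.eps ∈ Icc C.eps C.om := left_mem_Icc.2 C.hepsom.le
  have hM := H.MT_pos
  have hU1 := C.hUlb x hx ξ hξ
  have hU2 := C.hUub x hx ξ hξ
  have hU10 := C.hU₁pos
  have hU0 : 0 < C.U x ξ := U_pos hx hξ
  have hTT : 0 ≤ C.Tc - T := sub_nonneg.2 hT.2
  have ha : 0 < √C.a := Real.sqrt_pos.2 (by linarith [C.one_le_a])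
  have hs := Real.sqrt_pos.2 (H.pos T hT ξ hξ)
  have hs0 := Real.sqrt_pos.2 (H.pos T hT C.eps hepsI)
  have hη : 0 < quasiEnergy f T ξ / (2 * T) := by positivity
  have hc := Real.cosh_pos (quasiEnergy f T ξ / (2 * T))
  have hd0 : 0 < C.eps / (2 * C.Tc) := by positivity
  have hκ := Real.tanh_sub_div_cosh_sq_pos hd0
  have hm : Real.tanh (C.eps / (2 * C.Tc)) -
          (C.eps / (2 * C.Tc)) / Real.cosh (C.eps / (2 * C.Tc)) ^ 2 ≤
      Real.tanh (quasiEnergy f T ξ / (2 * T)) - quasiEnergy f T ξ / (2 * T) /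
          Real.cosh (quasiEnergy f T ξ / (2 * T)) ^ 2 :=
    Real.strictMonoOn_tanh_sub_div_cosh_sq.monotoneOn hd0.le hη.le
      (div_le_div₀ hE.le (hξ.1.trans hEξ) (by positivity) (by linarith [hT.2]))
  have hJ : (ξ ^ 2 + C.Δ₂ 0 ^ 2) ^ (-(3 : ℝ) / 2) ≤ 1 / quasiEnergy f T ξ ^ 3 := by
    have h1 := Real.rpow_le_rpow_of_nonpos (by positivity) (H.quasiEnergy_sq_le hT hξ)
      (by norm_num : -(3 : ℝ) / 2 ≤ 0)
    refine h1.trans_eq ?_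
    rw [← Real.rpow_natCast (quasiEnergy f T ξ) 2, ← Real.rpow_mul hE.le, one_div,
      ← Real.rpow_natCast (quasiEnergy f T ξ) 3, ← Real.rpow_neg hE.le]
    norm_num
  have hcosh : 1 / (T ^ 2 * Real.cosh (quasiEnergy f T ξ / (2 * T)) ^ 2) ≤
      4 * C.Mz ^ 2 * (1 / ξ ^ 2) := by
    have h1 : quasiEnergy f T ξ / (2 * T) / Real.cosh (quasiEnergy f T ξ / (2 * T)) ≤ C.Mz :=
      C.hMz.2 ⟨_, hη.le, rfl⟩
    have h2 := pow_le_pow_left₀ (by positivity) h1 2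
    have h3 : 1 / (T ^ 2 * Real.cosh (quasiEnergy f T ξ / (2 * T)) ^ 2) =
        4 * (quasiEnergy f T ξ / (2 * T) / Real.cosh (quasiEnergy f T ξ / (2 * T))) ^ 2 *
          (1 / quasiEnergy f T ξ ^ 2) := by
      generalize Real.cosh (quasiEnergy f T ξ / (2 * T)) = c at *
      field_simp
      norm_num
    rw [h3]
    gcongr
  have hJ0 : (0 : ℝ) ≤ (ξ ^ 2 + C.Δ₂ 0 ^ 2) ^ (-(3 : ℝ) / 2) := by positivity
  have hlow : √(h T C.eps) / √C.a ≤ √(h T ξ) := by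
    rw [div_le_iff₀ ha, mul_comm]
    exact H.sqrt_le hT hepsI hξ
  have hup := H.sqrt_le hT hξ hepsI
  have hmain := mul_le_mul_of_nonneg_right (H.neg_deriv_le T hT ξ hξ) (H.main_factor_pos hT hξ).le
  rw [H.derivKernel_eq hT hξ]
  generalize Real.tanh (quasiEnergy f T ξ / (2 * T)) - quasiEnergy f T ξ / (2 * T) /
    Real.cosh (quasiEnergy f T ξ / (2 * T)) ^ 2 = m at *
  generalize Real.tanh (C.eps / (2 * C.Tc)) -
    (C.eps / (2 * C.Tc)) / Real.cosh (C.eps / (2 * C.Tc)) ^ 2 = κ at *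
  generalize (ξ ^ 2 + C.Δ₂ 0 ^ 2) ^ (-(3 : ℝ) / 2) = J at *
  have hneg : C.U₁ * (√(h T C.eps) / √C.a) * κ * J ≤
      C.U x ξ * √(h T ξ) * m * (1 / quasiEnergy f T ξ ^ 3) := by
    have : 0 < m := hκ.trans_le hm
    gcongr
  have hpos : C.U x ξ * √(h T ξ) *
      (1 / (T ^ 2 * Real.cosh (quasiEnergy f T ξ / (2 * T)) ^ 2)) ≤
      C.U₂ * (√C.a * √(h T C.eps)) * (4 * C.Mz ^ 2 * (1 / ξ ^ 2)) := by
    have : 0 ≤ C.U₂ := hU0.le.trans hU2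
    gcongr
  have h1 := mul_le_mul_of_nonneg_left hmain hU0.le
  have h2 := mul_le_mul_of_nonneg_left hneg (mul_nonneg hM.le hTT)
  have h3 := mul_le_mul_of_nonneg_left hpos hTT
  calc _ ≤ C.U x ξ * (C.MT * (gapKernel f T ξ / √(h T ξ) -
            (C.Tc - T) * √(h T ξ) * m / quasiEnergy f T ξ ^ 3)) +
          (C.Tc - T) * (C.U x ξ * √(h T ξ) *
            (1 / (T ^ 2 * Real.cosh (quasiEnergy f T ξ / (2 * T)) ^ 2))) := by
        rw [mul_add]
        refine add_le_add h1 (le_of_eq ?_)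
        ring
    _ = C.MT * (C.U x ξ * (gapKernel f T ξ / √(h T ξ))) -
          C.MT * (C.Tc - T) * (C.U x ξ * √(h T ξ) * m * (1 / quasiEnergy f T ξ ^ 3)) +
          (C.Tc - T) * (C.U x ξ * √(h T ξ) *
            (1 / (T ^ 2 * Real.cosh (quasiEnergy f T ξ / (2 * T)) ^ 2))) := by ring
    _ ≤ C.MT * (C.U x ξ * (gapKernel f T ξ / √(h T ξ))) -
          C.MT * (C.Tc - T) * (C.U₁ * (√(h T C.eps) / √C.a) * κ * J) +
          (C.Tc - T) * (C.U₂ * (√C.a * √(h T C.eps)) * (4 * C.Mz ^ 2 * (1 / ξ ^ 2))) :=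
        add_le_add (sub_le_sub_left h2 _) h3
    _ = _ := by ring

end Bounds

end IsFactorization

namespace IsFactorization

variable {C : BCSContext} {f h f₁ k₁ : ℝ → ℝ → ℝ}

section DerivBound

variable (H : IsFactorization C f h f₁ k₁)
include H

lemma intervalIntegrable_gapKernel {T x : ℝ} (hT : T ∈ Icc C.T₀ C.Tc)
    (hx : x ∈ Icc C.eps C.om) :
    IntervalIntegrable (fun ξ => C.U x ξ * gapKernel f T ξ) volume C.eps C.om :=
  ((continuousOn_U_slice hx).mul
    (H.contDiffOn_kernel.continuousOn.slice_snd hT)).intervalIntegrable_of_Icc C.hepsom.le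

lemma intervalIntegrable_gapKernel_div {T x : ℝ} (hT : T ∈ Icc C.T₀ C.Tc)
    (hx : x ∈ Icc C.eps C.om) :
    IntervalIntegrable (fun ξ => C.U x ξ * (gapKernel f T ξ / √(h T ξ))) volume C.eps C.om :=
  ((continuousOn_U_slice hx).mul
    ((H.contDiffOn_kernel.continuousOn.slice_snd hT).div
      (ContinuousOn.slice_snd (g := fun T ξ => √(h T ξ)) H.contDiffOn_sqrt.continuousOn hT) fun ξ hξ =>
        (Real.sqrt_pos.2 (H.pos T hT ξ hξ)).ne')).intervalIntegrable_of_Icc C.hepsom.le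

lemma integral_derivKernel_pos {T x : ℝ} (hT : T ∈ Icc C.T₀ C.Tc) (hx : x ∈ Icc C.eps C.om) :
    0 < ∫ ξ in C.eps..C.om, C.U x ξ * derivKernel C f h f₁ k₁ T ξ :=
  intervalIntegral.intervalIntegral_pos_of_pos_on (H.intervalIntegrable_derivKernel hT hx)
    (fun _ hξ => mul_pos (U_pos hx (Ioo_subset_Icc_self hξ))
      (H.derivKernel_pos hT (Ioo_subset_Icc_self hξ))) C.hepsom

lemma integral_derivKernel_le {T x : ℝ} (hT : T ∈ Icc C.T₀ C.Tc) (hx : x ∈ Icc C.eps C.om) :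
    ∫ ξ in C.eps..C.om, C.U x ξ * derivKernel C f h f₁ k₁ T ξ ≤
      C.MT * ∫ ξ in C.eps..C.om, C.U x ξ * (gapKernel f T ξ / √(h T ξ)) := by
  have i1 := (H.intervalIntegrable_gapKernel_div hT hx).const_mul C.MT
  have i2 := C.intervalIntegrable_one_div_sq.const_mul (4 * C.Mz ^ 2 * C.U₂ * √C.a)
  have i3 := C.intervalIntegrable_rpow.const_mul (C.MT * C.U₁ *
    (Real.tanh (C.eps / (2 * C.Tc)) -
      (C.eps / (2 * C.Tc)) / Real.cosh (C.eps / (2 * C.Tc)) ^ 2) / √C.a)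
  have key := intervalIntegral.integral_mono_on C.hepsom.le
    (H.intervalIntegrable_derivKernel hT hx)
    (i1.add ((i2.sub i3).const_mul ((C.Tc - T) * √(h T C.eps))))
    (fun ξ hξ => H.remainder_le hT hx hξ)
  refine key.trans ?_
  rw [intervalIntegral.integral_add i1 ((i2.sub i3).const_mul _),
    intervalIntegral.integral_const_mul, intervalIntegral.integral_const_mul,
    intervalIntegral.integral_sub i2 i3,
    intervalIntegral.integral_const_mul, intervalIntegral.integral_const_mul]
  have hMT := C.MT_mul_eq
  have hI := C.integral_one_div_sq_le
  have heps := C.heps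
  have hU2 : 0 < C.U₂ := C.hU₁pos.trans_le C.hU₁₂
  have hTT : 0 ≤ C.Tc - T := sub_nonneg.2 hT.2
  have ha0 : 0 < C.a := by linarith [C.one_le_a]
  have ha : 0 < √C.a := Real.sqrt_pos.2 ha0
  have ha2 := Real.sq_sqrt ha0.le
  generalize Real.tanh (C.eps / (2 * C.Tc)) -
    (C.eps / (2 * C.Tc)) / Real.cosh (C.eps / (2 * C.Tc)) ^ 2 = κ at *
  generalize (∫ ξ in C.eps..C.om, (ξ ^ 2 + C.Δ₂ 0 ^ 2) ^ (-(3 : ℝ) / 2)) = R at *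
  have e : C.MT * C.U₁ * κ / √C.a * R = 4 * C.Mz ^ 2 * C.U₂ * √C.a * (1 / C.eps) := by
    have : √C.a * √C.a = C.a := by rw [← sq, ha2]
    field_simp
    rw [ha2]
    linarith
  have h1 := mul_le_mul_of_nonneg_left hI
    (by positivity : 0 ≤ 4 * C.Mz ^ 2 * C.U₂ * √C.a)
  have h2 := mul_nonpos_of_nonneg_of_nonpos (mul_nonneg hTT (Real.sqrt_nonneg (h T C.eps)))
    (sub_nonpos.2 (h1.trans_eq e.symm))
  linarith

lemma integral_reducedKernel_le {T x ξ : ℝ} (hT : T ∈ Icc C.T₀ C.Tc)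
    (hx : x ∈ Icc C.eps C.om) (hξ : ξ ∈ Icc C.eps C.om) :
    ∫ η in C.eps..C.om, C.U x η * reducedKernel f h T η ≤
      √C.a * √(h T ξ) * ∫ η in C.eps..C.om, C.U x η * gapKernel f T η := by
  rw [← intervalIntegral.integral_const_mul]
  refine intervalIntegral.integral_mono_on C.hepsom.le (H.intervalIntegrable_reducedKernel hT hx)
    ((H.intervalIntegrable_gapKernel hT hx).const_mul _) fun η hη => ?_
  have := mul_le_mul_of_nonneg_right (H.sqrt_le hT hη hξ) (mul_pos (U_pos hx hη)
    (gapKernel_pos (C.T_pos hT) (C.energy_pos hη) (H.nonneg T hT η hη))).le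
  rw [reducedKernel]
  linarith

lemma integral_gapKernel_le {T x : ℝ} (hT : T ∈ Icc C.T₀ C.Tc) (hx : x ∈ Icc C.eps C.om) :
    ∫ ξ in C.eps..C.om, C.U x ξ * gapKernel f T ξ ≤
      ∫ ξ in C.eps..C.om, C.U x ξ / ξ * Real.tanh (ξ / (2 * T)) := by
  have hT0 := C.T_pos hT
  refine intervalIntegral.integral_mono_on C.hepsom.le (H.intervalIntegrable_gapKernel hT hx)
    (ContinuousOn.intervalIntegrable_of_Icc C.hepsom.le ?_) fun ξ hξ => ?_
  · exact ((continuousOn_U_slice hx).div continuousOn_id fun ξ hξ => (C.energy_pos hξ).ne').mul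
      (Real.contDiff_tanh (n := 0).continuous.comp_continuousOn (by fun_prop))
  · have h1 := Real.tanh_div_div_self_le (C.energy_pos hξ) (le_quasiEnergy (H.nonneg T hT ξ hξ))
      (by positivity : 0 < 2 * T)
    have h2 := mul_le_mul_of_nonneg_left h1 (U_pos hx hξ).le
    rw [gapKernel]
    refine h2.trans_eq ?_
    ring

lemma integral_mul_integral_le (hcond : gapCondition C) {T x : ℝ} (hT : T ∈ Icc C.T₀ C.Tc)
    (hx : x ∈ Icc C.eps C.om) :
    (∫ ξ in C.eps..C.om, C.U x ξ * reducedKernel f h T ξ) *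
      (∫ ξ in C.eps..C.om, C.U x ξ * (gapKernel f T ξ / √(h T ξ))) ≤ 1 := by
  have ha0 : 0 < C.a := by linarith [C.one_le_a]
  have hK := H.integral_gapKernel_le hT hx
  have hK0 : 0 ≤ ∫ ξ in C.eps..C.om, C.U x ξ * gapKernel f T ξ :=
    intervalIntegral.integral_nonneg C.hepsom.le fun ξ hξ => (mul_pos (U_pos hx hξ)
      (gapKernel_pos (C.T_pos hT) (C.energy_pos hξ) (H.nonneg T hT ξ hξ))).le
  have hq : 0 < C.a ^ ((1 : ℝ) / 4) := Real.rpow_pos_of_pos ha0 _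
  have hq2 : √C.a = (C.a ^ ((1 : ℝ) / 4)) ^ 2 := by
    rw [Real.sqrt_eq_rpow, ← Real.rpow_natCast, ← Real.rpow_mul ha0.le]
    norm_num
  have h1 : C.a ^ ((1 : ℝ) / 4) * (∫ ξ in C.eps..C.om, C.U x ξ * gapKernel f T ξ) ≤ 1 :=
    (mul_le_mul_of_nonneg_left hK hq.le).trans (hcond T hT x hx)
  calc _ = ∫ ξ in C.eps..C.om, (∫ η in C.eps..C.om, C.U x η * reducedKernel f h T η) *
          (C.U x ξ * (gapKernel f T ξ / √(h T ξ))) :=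
        (intervalIntegral.integral_const_mul _ _).symm
    _ ≤ ∫ ξ in C.eps..C.om, √C.a * (∫ η in C.eps..C.om, C.U x η * gapKernel f T η) *
          (C.U x ξ * gapKernel f T ξ) := by
        refine intervalIntegral.integral_mono_on C.hepsom.le
          ((H.intervalIntegrable_gapKernel_div hT hx).const_mul _)
          ((H.intervalIntegrable_gapKernel hT hx).const_mul _) fun ξ hξ => ?_
        have hs := Real.sqrt_pos.2 (H.pos T hT ξ hξ)
        have hk := gapKernel_pos (C.T_pos hT) (C.energy_pos hξ) (H.nonneg T hT ξ hξ)
        refine (mul_le_mul_of_nonneg_right (H.integral_reducedKernel_le hT hx hξ)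
          (mul_pos (U_pos hx hξ) (div_pos hk hs)).le).trans_eq ?_
        field_simp
    _ = (C.a ^ ((1 : ℝ) / 4) * ∫ ξ in C.eps..C.om, C.U x ξ * gapKernel f T ξ) ^ 2 := by
        rw [intervalIntegral.integral_const_mul, hq2]
        ring
    _ ≤ 1 := pow_le_one₀ (by positivity) h1

lemma neg_deriv_opA_le (hcond : gapCondition C) {T x : ℝ} (hT : T ∈ Icc C.T₀ C.Tc)
    (hx : x ∈ Icc C.eps C.om) :
    (∫ ξ in C.eps..C.om, C.U x ξ * reducedKernel f h T ξ) *
      (∫ ξ in C.eps..C.om, C.U x ξ * derivKernel C f h f₁ k₁ T ξ) ≤ C.MT := by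
  have h1 := mul_le_mul_of_nonneg_left (H.integral_derivKernel_le hT hx)
    (H.integral_reducedKernel_pos hT hx).le
  have h2 := mul_le_mul_of_nonneg_left (H.integral_mul_integral_le hcond hT hx) H.MT_pos.le
  linarith

lemma pderivT_opA {T x : ℝ} (hT : T ∈ Icc C.T₀ C.Tc) (hx : x ∈ Icc C.eps C.om) :
    pderivT C (opA C f) T x = -((∫ ξ in C.eps..C.om, C.U x ξ * reducedKernel f h T ξ) *
      ∫ ξ in C.eps..C.om, C.U x ξ * derivKernel C f h f₁ k₁ T ξ) :=
  (H.hasDerivWithinAt_opA hT hx).derivWithin (uniqueDiffOn_Icc C.hT₀₂ T hT)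

lemma pderivT_opA_Tc {x : ℝ} (hx : x ∈ Icc C.eps C.om) :
    -pderivT C (opA C f) C.Tc x =
      (∫ ξ in C.eps..C.om, C.U x ξ * reducedKernel f h C.Tc ξ) ^ 2 := by
  have hT : C.Tc ∈ Icc C.T₀ C.Tc := right_mem_Icc.2 C.hT₀₂.le
  obtain ⟨p₁, -, -, hp⟩ := H.hasDerivWithinAt_reducedKernel
  rw [H.pderivT_opA hT hx, neg_neg, sq]
  congr 1
  refine intervalIntegral.integral_congr fun ξ hξ => ?_
  rw [uIcc_of_le C.hepsom.le] at hξ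
  simp [hp C.Tc hT ξ hξ]

lemma integral_sq_le_a_mul {T x y : ℝ} (hT : T ∈ Icc C.T₀ C.Tc) (hx : x ∈ Icc C.eps C.om)
    (hy : y ∈ Icc C.eps C.om) :
    (∫ ξ in C.eps..C.om, C.U x ξ * reducedKernel f h T ξ) ^ 2 ≤
      C.a * (∫ ξ in C.eps..C.om, C.U y ξ * reducedKernel f h T ξ) ^ 2 := by
  rw [C.ha, ← mul_pow]
  refine pow_le_pow_left₀ (H.integral_reducedKernel_pos hT hx).le ?_ 2
  rw [← intervalIntegral.integral_const_mul]
  refine intervalIntegral.integral_mono_on C.hepsom.le (H.intervalIntegrable_reducedKernel hT hx)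
    ((H.intervalIntegrable_reducedKernel hT hy).const_mul _) fun ξ hξ => ?_
  have h1 : C.U x ξ ≤ C.Umax := C.hUmax.2 (mem_image2_of_mem hx hξ)
  have h2 : C.Umin ≤ C.U y ξ := C.hUmin.2 (mem_image2_of_mem hy hξ)
  have h0 := C.Umin_pos
  have h3 : C.U x ξ ≤ C.Umax / C.Umin * C.U y ξ := by
    rw [div_mul_eq_mul_div, le_div_iff₀ h0]
    exact mul_le_mul h1 h2 h0.le (h0.le.trans C.Umin_le_Umax)
  rw [← mul_assoc]
  exact mul_le_mul_of_nonneg_right h3 (H.reducedKernel_pos hT hξ).le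

end DerivBound

end IsFactorization

section Gap

variable {C : BCSContext} {f : ℝ → ℝ → ℝ}

lemma sqrt_div_mul_tanh_le {ξ y d t : ℝ} (hξ : 0 < ξ) (hy : 0 ≤ y) (hyd : y ≤ d ^ 2)
    (hd : 0 ≤ d) (ht : 0 < t) :
    √(y / (ξ ^ 2 + y)) * Real.tanh (√(ξ ^ 2 + y) / t) ≤
      d * (Real.tanh (√(ξ ^ 2 + d ^ 2) / t) / √(ξ ^ 2 + d ^ 2)) := by
  have h1 : √(y / (ξ ^ 2 + y)) ≤ d / √(ξ ^ 2 + d ^ 2) := by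
    rw [← Real.sqrt_sq hd, Real.sq_sqrt (sq_nonneg d), ← Real.sqrt_div (sq_nonneg d)]
    refine Real.sqrt_le_sqrt ?_
    rw [div_le_div_iff₀ (by positivity) (by positivity)]
    nlinarith [mul_le_mul_of_nonneg_left hyd (sq_nonneg ξ)]
  have h2 : Real.tanh (√(ξ ^ 2 + y) / t) ≤ Real.tanh (√(ξ ^ 2 + d ^ 2) / t) :=
    Real.strictMono_tanh.monotone (by gcongr)
  refine (mul_le_mul h1 h2 (Real.tanh_pos (by positivity)).le (by positivity)).trans_eq ?_
  ring

/-- The factor of the integrand of the operator that does not involve the potential. -/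
def amplitude (f : ℝ → ℝ → ℝ) (T ξ : ℝ) : ℝ :=
  √(f T ξ / (ξ ^ 2 + f T ξ)) * Real.tanh (√(ξ ^ 2 + f T ξ) / (2 * T))

lemma opA_eq_integral_amplitude (C : BCSContext) (f : ℝ → ℝ → ℝ) (T x : ℝ) :
    opA C f T x = (∫ ξ in C.eps..C.om, C.U x ξ * amplitude f T ξ) ^ 2 := by
  simp only [opA, amplitude, mul_assoc]

lemma memW.nonneg (hf : memW C f) {T x : ℝ} (hT : T ∈ Icc C.T₀ C.Tc)
    (hx : x ∈ Icc C.eps C.om) : 0 ≤ f T x :=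
  (sq_nonneg _).trans (hf.2.1 T hT x hx).1

lemma memW.amplitude_nonneg (hf : memW C f) {T ξ : ℝ} (hT : T ∈ Icc C.T₀ C.Tc)
    (hξ : ξ ∈ Icc C.eps C.om) : 0 ≤ amplitude f T ξ := by
  have hT0 := C.T_pos hT
  have hξ0 := C.energy_pos hξ
  have h0 := hf.nonneg hT hξ
  exact mul_nonneg (Real.sqrt_nonneg _) (Real.tanh_pos (by positivity)).le

lemma memW.amplitude_le_one (hf : memW C f) {T ξ : ℝ} (hT : T ∈ Icc C.T₀ C.Tc)
    (hξ : ξ ∈ Icc C.eps C.om) : amplitude f T ξ ≤ 1 := by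
  have hT0 := C.T_pos hT
  have hξ0 := C.energy_pos hξ
  have h0 := hf.nonneg hT hξ
  refine mul_le_one₀ (Real.sqrt_le_one.2 ?_) (Real.tanh_pos (by positivity)).le
    (Real.tanh_lt_one _).le
  exact div_le_one_of_le₀ (by linarith [sq_nonneg ξ]) (by positivity)

lemma memW.continuousOn_amplitude (hf : memW C f) {T : ℝ} (hT : T ∈ Icc C.T₀ C.Tc) :
    ContinuousOn (fun ξ => amplitude f T ξ) (Icc C.eps C.om) := by
  have hc : ContinuousOn (fun ξ => f T ξ) (Icc C.eps C.om) := hf.1.continuousOn.slice_snd hT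
  have hs : ContinuousOn (fun ξ => ξ ^ 2 + f T ξ) (Icc C.eps C.om) :=
    (continuousOn_id.pow 2).add hc
  refine ((hc.div hs fun ξ hξ => ?_).sqrt).mul
    (Real.contDiff_tanh (n := 0).continuous.comp_continuousOn (hs.sqrt.div_const _))
  have := C.energy_pos hξ
  have := hf.nonneg hT hξ
  positivity

lemma memW.intervalIntegrable_amplitude (hf : memW C f) {T x : ℝ} (hT : T ∈ Icc C.T₀ C.Tc)
    (hx : x ∈ Icc C.eps C.om) :
    IntervalIntegrable (fun ξ => C.U x ξ * amplitude f T ξ) volume C.eps C.om :=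
  ((IsFactorization.continuousOn_U_slice hx).mul
    (hf.continuousOn_amplitude hT)).intervalIntegrable_of_Icc C.hepsom.le

lemma memW.integral_amplitude_nonneg (hf : memW C f) {T x : ℝ} (hT : T ∈ Icc C.T₀ C.Tc)
    (hx : x ∈ Icc C.eps C.om) : 0 ≤ ∫ ξ in C.eps..C.om, C.U x ξ * amplitude f T ξ :=
  intervalIntegral.integral_nonneg C.hepsom.le fun _ hξ =>
    mul_nonneg (IsFactorization.U_pos hx hξ).le (hf.amplitude_nonneg hT hξ)

lemma memW.integral_amplitude_le (hf : memW C f) {T x : ℝ} (hT : T ∈ Icc C.T₀ C.Tc)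
    (hx : x ∈ Icc C.eps C.om) :
    ∫ ξ in C.eps..C.om, C.U x ξ * amplitude f T ξ ≤ C.Δ₂ T := by
  have hT0 := C.T_pos hT
  have hgap := C.hΔ₂eq T ⟨hT0, hT.2.trans C.hTc₂⟩
  have hd := C.hΔ₂nonneg T
  have hcont : ContinuousOn (fun ξ : ℝ => Real.tanh (√(ξ ^ 2 + C.Δ₂ T ^ 2) / (2 * T)) /
      √(ξ ^ 2 + C.Δ₂ T ^ 2)) (Icc C.eps C.om) := by
    refine ContinuousOn.div (Real.contDiff_tanh (n := 0).continuous.comp_continuousOn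
      (by fun_prop)) (by fun_prop) fun ξ hξ => ?_
    have := C.energy_pos hξ
    positivity
  calc _ ≤ ∫ ξ in C.eps..C.om, C.Δ₂ T * C.U₂ * (Real.tanh (√(ξ ^ 2 + C.Δ₂ T ^ 2) / (2 * T)) /
        √(ξ ^ 2 + C.Δ₂ T ^ 2)) := by
        refine intervalIntegral.integral_mono_on C.hepsom.le (hf.intervalIntegrable_amplitude hT hx)
          ((hcont.intervalIntegrable_of_Icc C.hepsom.le).const_mul _) fun ξ hξ => ?_
        have h1 := sqrt_div_mul_tanh_le (C.energy_pos hξ) (hf.nonneg hT hξ) (hf.2.1 T hT ξ hξ).2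
          hd (by positivity : 0 < 2 * T)
        have hU := C.hUub x hx ξ hξ
        refine (mul_le_mul hU h1 (hf.amplitude_nonneg hT hξ)
          ((IsFactorization.U_pos hx hξ).le.trans hU)).trans_eq ?_
        ring
    _ = C.Δ₂ T := by rw [intervalIntegral.integral_const_mul, mul_assoc, hgap, mul_one]

lemma memW.opA_le (hf : memW C f) {T x : ℝ} (hT : T ∈ Icc C.T₀ C.Tc)
    (hx : x ∈ Icc C.eps C.om) : opA C f T x ≤ C.Δ₂ T ^ 2 := by
  rw [opA_eq_integral_amplitude]
  exact pow_le_pow_left₀ (hf.integral_amplitude_nonneg hT hx) (hf.integral_amplitude_le hT hx) 2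

theorem memW.memW_opA (hcond : gapCondition C) (hf : memW C f) : memW C (opA C f) := by
  obtain ⟨h, f₁, k₁, H⟩ := hf.exists_isFactorization
  have hTc : C.Tc ∈ Icc C.T₀ C.Tc := right_mem_Icc.2 C.hT₀₂.le
  refine ⟨H.contDiffOn_opA, fun T hT x hx => ⟨?_, hf.opA_le hT hx⟩, fun x _ => ?_,
    fun T hT x hx y hy => ?_, fun x hx y hy => ?_, fun T hT x hx => ?_, fun T hT x hx => ?_⟩
  · rw [C.hΔ₁zero T (C.hT₀₁.le.trans hT.1), zero_pow two_ne_zero]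
    exact sq_nonneg _
  · rw [H.opA_eq hTc, sub_self, zero_mul]
  · have hT' := Ico_subset_Icc_self hT
    rw [H.opA_eq hT', H.opA_eq hT', mul_left_comm]
    exact mul_le_mul_of_nonneg_left (H.integral_sq_le_a_mul hT' hx hy) (sub_nonneg.2 hT.2.le)
  · rw [H.pderivT_opA_Tc hx, H.pderivT_opA_Tc hy]
    exact H.integral_sq_le_a_mul hTc hx hy
  · rw [H.pderivT_opA hT hx]
    exact neg_neg_of_pos
      (mul_pos (H.integral_reducedKernel_pos hT hx) (H.integral_derivKernel_pos hT hx))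
  · rw [H.pderivT_opA hT hx, neg_neg]
    exact H.neg_deriv_opA_le hcond hT hx

lemma BCSContext.exists_lipschitz_U (C : BCSContext) : ∃ L, 0 ≤ L ∧
    ∀ x ∈ Icc C.eps C.om, ∀ y ∈ Icc C.eps C.om, ∀ ξ ∈ Icc C.eps C.om,
      |C.U x ξ - C.U y ξ| ≤ L * |x - y| := by
  obtain ⟨U₁, -, cU₁, -, dU, -⟩ := exists_partials_of_contDiffOn_succ C.hepsom C.hepsom (n := 1)
    (g := C.U) (C.hUsmooth.of_le (by norm_num))
  obtain ⟨L, hL⟩ := (isCompact_Icc.prod isCompact_Icc).exists_bound_of_continuousOn cU₁.continuousOn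
  have he : C.eps ∈ Icc C.eps C.om := left_mem_Icc.2 C.hepsom.le
  refine ⟨L, (norm_nonneg _).trans (hL (C.eps, C.eps) ⟨he, he⟩), fun x hx y hy ξ hξ => ?_⟩
  exact (convex_Icc C.eps C.om).norm_image_sub_le_of_norm_hasDerivWithin_le
    (f := fun z => C.U z ξ) (fun z hz => dU z hz ξ hξ) (fun z hz => hL (z, ξ) ⟨hz, hξ⟩) hy hx

lemma memW.abs_opA_sub_le_snd {L : ℝ} (hL : ∀ x ∈ Icc C.eps C.om, ∀ y ∈ Icc C.eps C.om,
      ∀ ξ ∈ Icc C.eps C.om, |C.U x ξ - C.U y ξ| ≤ L * |x - y|) (hf : memW C f) {T x y : ℝ}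
    (hT : T ∈ Icc C.T₀ C.Tc) (hx : x ∈ Icc C.eps C.om) (hy : y ∈ Icc C.eps C.om) :
    |opA C f T x - opA C f T y| ≤ 2 * C.Δ₂ 0 * (L * (C.om - C.eps)) * |x - y| := by
  have h1 : |(∫ ξ in C.eps..C.om, C.U x ξ * amplitude f T ξ) -
      ∫ ξ in C.eps..C.om, C.U y ξ * amplitude f T ξ| ≤ L * |x - y| * |C.om - C.eps| := by
    rw [← intervalIntegral.integral_sub (hf.intervalIntegrable_amplitude hT hx)
      (hf.intervalIntegrable_amplitude hT hy), ← Real.norm_eq_abs]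
    refine intervalIntegral.norm_integral_le_of_norm_le_const fun ξ hξ => ?_
    rw [uIoc_of_le C.hepsom.le] at hξ
    have hξ' := Ioc_subset_Icc_self hξ
    rw [← sub_mul, norm_mul, Real.norm_eq_abs, Real.norm_of_nonneg (hf.amplitude_nonneg hT hξ')]
    exact (mul_le_of_le_one_right (abs_nonneg _) (hf.amplitude_le_one hT hξ')).trans
      (hL x hx y hy ξ hξ')
  have h2 : |(∫ ξ in C.eps..C.om, C.U x ξ * amplitude f T ξ) +
      ∫ ξ in C.eps..C.om, C.U y ξ * amplitude f T ξ| ≤ 2 * C.Δ₂ 0 := by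
    rw [abs_of_nonneg (add_nonneg (hf.integral_amplitude_nonneg hT hx)
      (hf.integral_amplitude_nonneg hT hy))]
    linarith [hf.integral_amplitude_le hT hx, hf.integral_amplitude_le hT hy, C.Δ₂_le hT]
  rw [abs_of_pos (sub_pos.2 C.hepsom)] at h1
  rw [opA_eq_integral_amplitude, opA_eq_integral_amplitude, sq_sub_sq, abs_mul]
  refine (mul_le_mul h2 h1 (abs_nonneg _) (by linarith [C.hΔ₂nonneg 0])).trans_eq ?_
  ring

lemma memW.abs_opA_sub_le_fst (hcond : gapCondition C) (hf : memW C f) {S T x : ℝ}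
    (hS : S ∈ Icc C.T₀ C.Tc) (hT : T ∈ Icc C.T₀ C.Tc) (hx : x ∈ Icc C.eps C.om) :
    |opA C f S x - opA C f T x| ≤ C.MT * |S - T| := by
  obtain ⟨h, f₁, k₁, H⟩ := hf.exists_isFactorization
  refine (convex_Icc C.T₀ C.Tc).norm_image_sub_le_of_norm_hasDerivWithin_le
    (f := fun s => opA C f s x) (fun s hs => H.hasDerivWithinAt_opA hs hx)
    (fun s hs => ?_) hT hS
  rw [norm_neg, Real.norm_of_nonneg (mul_pos (H.integral_reducedKernel_pos hs hx)
    (H.integral_derivKernel_pos hs hx)).le]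
  exact H.neg_deriv_opA_le hcond hs hx

lemma exists_lipschitz_opA (hcond : gapCondition C) : ∃ K : ℝ, ∀ f, memW C f →
    ∀ p ∈ C.Dset, ∀ q ∈ C.Dset, |opA C f p.1 p.2 - opA C f q.1 q.2| ≤ K * dist p q := by
  obtain ⟨L, hL0, hL⟩ := C.exists_lipschitz_U
  refine ⟨C.MT + 2 * C.Δ₂ 0 * (L * (C.om - C.eps)), fun f hf p hp q hq => ?_⟩
  obtain ⟨h, f₁, k₁, H⟩ := hf.exists_isFactorization
  have h1 := hf.abs_opA_sub_le_fst hcond hp.1 hq.1 hp.2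
  have h2 := hf.abs_opA_sub_le_snd hL hq.1 hp.2 hq.2
  have h3 : |p.1 - q.1| ≤ dist p q := le_max_left _ _
  have h4 : |p.2 - q.2| ≤ dist p q := le_max_right _ _
  have hc : 0 ≤ 2 * C.Δ₂ 0 * (L * (C.om - C.eps)) :=
    mul_nonneg (mul_nonneg two_pos.le (C.hΔ₂nonneg 0))
      (mul_nonneg hL0 (sub_nonneg.2 C.hepsom.le))
  calc _ ≤ _ := abs_sub_le _ (opA C f q.1 p.2) _
    _ ≤ _ := add_le_add (h1.trans (mul_le_mul_of_nonneg_left h3 H.MT_pos.le))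
        (h2.trans (mul_le_mul_of_nonneg_left h4 hc))
    _ = _ := by ring

end Gap

/-- A form of the Arzelà–Ascoli theorem: a bounded, uniformly Lipschitz family of real functions
on a compact metric space is relatively compact. -/
lemma isCompact_closure_of_lipschitz {α : Type*} [MetricSpace α] [CompactSpace α]
    {A : Set C(α, ℝ)} {K M : ℝ} (hM : ∀ F ∈ A, ∀ p, |F p| ≤ M)
    (hK : ∀ F ∈ A, ∀ p q, |F p - F q| ≤ K * dist p q) : IsCompact (closure A) := by
  set e := (ContinuousMap.isometryEquivBoundedOfCompact α ℝ).toHomeomorph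
  rw [← e.isCompact_image, e.image_closure]
  refine BoundedContinuousFunction.arzela_ascoli (Icc (-M) M) isCompact_Icc _ ?_ ?_
  · rintro _ p ⟨F, hF, rfl⟩
    exact abs_le.1 (hM F hF p)
  · refine Metric.equicontinuous_of_continuity_modulus (fun d => K * d) ?_ _ ?_
    · simpa using (continuous_const_mul K).tendsto (0 : ℝ)
    · rintro p q ⟨_, F, hF, rfl⟩
      exact hK F hF p q

theorem stmt_13 (C : BCSContext) (hcond : gapCondition C) :
    (∀ f : ℝ → ℝ → ℝ, memW C f → memW C (opA C f)) ∧
    IsCompact (closure {F : C(↥C.Dset, ℝ) | ∃ f : ℝ → ℝ → ℝ, memW C f ∧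
        ∀ p : ↥C.Dset, F p = opA C f (p : ℝ × ℝ).1 (p : ℝ × ℝ).2}) := by
  refine ⟨fun f hf => hf.memW_opA hcond, ?_⟩
  obtain ⟨K, hK⟩ := exists_lipschitz_opA hcond
  refine isCompact_closure_of_lipschitz (K := K) (M := C.Δ₂ 0 ^ 2) ?_ ?_
  · rintro F ⟨f, hf, hF⟩ p
    rw [hF p, abs_of_nonneg (sq_nonneg _)]
    exact (hf.opA_le p.2.1 p.2.2).trans
      (pow_le_pow_left₀ (C.hΔ₂nonneg _) (C.Δ₂_le p.2.1) 2)
  · rintro F ⟨f, hf, hF⟩ p q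
    rw [hF p, hF q]
    exact hK f hf p p.2 q q.2

end
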